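/- There exist an absolute constant C > 0 and an absolute constant N₀ such that for every integer N ≥ N₀ and every prime p with p ≤ (log N)/(log log N)², the number of pairs (χ, c), where χ is an irreducible complex character of the symmetric group S_N and c is a conjugacy class of S_N, such that the value of χ on c is not of the form p·m for any integer m, is at most C · p(N)² · N^(−1/(12p)). -/

import Mathlib

open CategoryTheory

open Module End in
theorem trace_pow_eq_sum_of_pow_succ_eq {V : Type*} [AddCommGroup V] [Module ℂ V]
    [FiniteDimensional ℂ V] (A : Module.End ℂ V) {n : ℕ} (hn : 0 < n) (hA : A ^ (n + 1) = A) :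
    ∃ (S : Finset ℂ) (d : ℂ → ℕ), (∀ μ ∈ S, μ ^ (n + 1) = μ) ∧
      ∀ k : ℕ, LinearMap.trace ℂ V (A ^ k) = ∑ μ ∈ S, (d μ : ℂ) * μ ^ k := by
  have hsep : (Polynomial.X ^ (n + 1) - Polynomial.X : Polynomial ℂ).Separable := by
    have h1 : (Polynomial.X ^ n - 1 : Polynomial ℂ).Separable := by
      rw [Polynomial.X_pow_sub_one_separable_iff]
      exact_mod_cast hn.ne'
    have h2 : (Polynomial.X ^ (n + 1) - Polynomial.X : Polynomial ℂ)
        = Polynomial.X * (Polynomial.X ^ n - 1) := by ring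
    rw [h2]
    refine Polynomial.Separable.mul Polynomial.separable_X h1 ?_
    refine ⟨Polynomial.X ^ (n - 1), -1, ?_⟩
    have : (Polynomial.X ^ (n - 1) * Polynomial.X : Polynomial ℂ) = Polynomial.X ^ n := by
      rw [← pow_succ, Nat.sub_add_cancel hn]
    rw [this]; ring
  have hss : A.IsSemisimple := by
    refine Module.End.isSemisimple_of_squarefree_aeval_eq_zero hsep.squarefree ?_
    simp [hA]
  have htop : ⨆ μ, A.eigenspace μ = ⊤ := by
    rw [← Module.End.iSup_maxGenEigenspace_eq_top A]
    congr 1; ext1 μ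
    exact (hss.isFinitelySemisimple.maxGenEigenspace_eq_eigenspace μ).symm
  have hInt := DirectSum.isInternal_submodule_of_iSupIndep_of_iSup_eq_top
    A.eigenspaces_iSupIndep htop
  have hfin : {μ | A.eigenspace μ ≠ ⊥}.Finite :=
    WellFoundedGT.finite_ne_bot_of_iSupIndep A.eigenspaces_iSupIndep
  have happ : ∀ μ (v : V), v ∈ A.eigenspace μ → ∀ k : ℕ, (A ^ k) v = μ ^ k • v := by
    intro μ v hv k
    rw [Module.End.mem_eigenspace_iff] at hv
    induction k with
    | zero => simp
    | succ k ih => rw [pow_succ, Module.End.mul_apply, hv, map_smul, ih, smul_smul, pow_succ,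
        mul_comm]
  refine ⟨hfin.toFinset, fun μ => Module.finrank ℂ (A.eigenspace μ), ?_, ?_⟩
  · intro μ hμ
    simp only [Set.Finite.mem_toFinset, Set.mem_ofPred_eq] at hμ
    obtain ⟨v, hv, hv0⟩ := Submodule.exists_mem_ne_zero_of_ne_bot hμ
    have h1 := happ μ v hv (n + 1)
    rw [hA, ← pow_one A, happ μ v hv 1, pow_one] at h1
    exact (smul_left_injective ℂ hv0 h1).symm
  · intro k
    have hmaps : ∀ μ, Set.MapsTo (A ^ k) (A.eigenspace μ) (A.eigenspace μ) := by
      intro μ v hv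
      rw [happ μ v hv k]
      exact Submodule.smul_mem _ _ hv
    rw [LinearMap.trace_eq_sum_trace_restrict' hInt hfin hmaps]
    refine Finset.sum_congr rfl fun μ _ => ?_
    have : (A ^ k).restrict (hmaps μ) = μ ^ k • LinearMap.id := by
      ext v
      exact happ μ v.1 v.2 k
    rw [this, map_smul, LinearMap.trace_id, smul_eq_mul, mul_comm]

theorem isIntegral_of_pow_succ_eq {n : ℕ} (hn : 0 < n) {μ : ℂ} (h : μ ^ (n + 1) = μ) :
    IsIntegral ℤ μ := by
  rcases eq_or_ne μ 0 with rfl | h0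
  · exact isIntegral_zero
  · refine IsIntegral.of_pow hn ?_
    have : μ ^ n = 1 := by
      rw [pow_succ] at h
      exact mul_right_cancel₀ h0 (by rw [h, one_mul])
    rw [this]
    exact isIntegral_one

theorem isIntegral_trace_of_pow_succ_eq {V : Type*} [AddCommGroup V] [Module ℂ V]
    [FiniteDimensional ℂ V] (A : Module.End ℂ V) {n : ℕ} (hn : 0 < n) (hA : A ^ (n + 1) = A) :
    IsIntegral ℤ (LinearMap.trace ℂ V A) := by
  obtain ⟨S, d, hS, htr⟩ := trace_pow_eq_sum_of_pow_succ_eq A hn hA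
  have h1 := htr 1
  simp only [pow_one] at h1
  rw [h1]
  refine IsIntegral.sum _ fun μ hμ => IsIntegral.mul ?_ (isIntegral_of_pow_succ_eq hn (hS μ hμ))
  simpa using isIntegral_algebraMap (R := ℤ) (A := ℂ) (x := (d μ : ℤ))

theorem exists_sum_pow_prime_pow_eq {R ι : Type*} [CommRing R] {p : ℕ} (hp : p.Prime) (a : ℕ)
    (s : Finset ι) (f : ι → R) :
    ∃ r, (∑ i ∈ s, f i) ^ p ^ a = ∑ i ∈ s, f i ^ p ^ a + p * r := by
  classical
  induction s using Finset.induction_on with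
  | empty => exact ⟨0, by simp [hp.ne_zero]⟩
  | insert i s hi ih =>
    obtain ⟨r, hr⟩ := ih
    obtain ⟨r', hr'⟩ := exists_add_pow_prime_pow_eq hp (f i) (∑ i ∈ s, f i) a
    exact ⟨r + f i * (∑ i ∈ s, f i) * r', by
      rw [Finset.sum_insert hi, Finset.sum_insert hi, hr', hr]; ring⟩

theorem exists_natCast_pow_prime_pow_eq (R : Type*) [CommRing R] {p : ℕ} (hp : p.Prime) (a d : ℕ) :
    ∃ r : R, (d : R) ^ p ^ a = d + p * r := by
  obtain ⟨r, hr⟩ := exists_sum_pow_prime_pow_eq (R := R) hp a (Finset.range d) (fun _ => 1)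
  exact ⟨r, by simpa using hr⟩

theorem exists_trace_pow_prime_pow_eq {V : Type*} [AddCommGroup V] [Module ℂ V]
    [FiniteDimensional ℂ V] (A : Module.End ℂ V) {n : ℕ} (hn : 0 < n) (hA : A ^ n = 1)
    {p : ℕ} (hp : p.Prime) (a : ℕ) :
    ∃ r : ℂ, IsIntegral ℤ r ∧
      LinearMap.trace ℂ V A ^ p ^ a = LinearMap.trace ℂ V (A ^ p ^ a) + p * r := by
  obtain ⟨S, d, hS, htr⟩ := trace_pow_eq_sum_of_pow_succ_eq A hn (by rw [pow_succ, hA, one_mul])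
  have h1 := htr 1
  simp only [pow_one] at h1
  rw [h1, htr]
  let O := integralClosure ℤ ℂ
  have key : ∃ f : ℂ → O, ∀ μ ∈ S, (f μ : ℂ) = μ := by
    classical
    refine ⟨fun μ => if h : μ ∈ S then ⟨μ, isIntegral_of_pow_succ_eq hn (hS μ h)⟩ else 0, ?_⟩
    intro μ hμ
    simp [hμ]
  obtain ⟨f, hf⟩ := key
  obtain ⟨r, hr⟩ := exists_sum_pow_prime_pow_eq hp a S (fun μ => (d μ : O) * f μ)
  choose g hg using fun μ : ℂ => exists_natCast_pow_prime_pow_eq O hp a (d μ)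
  refine ⟨((r + ∑ μ ∈ S, g μ * f μ ^ p ^ a : O) : ℂ), (r + ∑ μ ∈ S, g μ * f μ ^ p ^ a : O).2, ?_⟩
  have h2 : (∑ μ ∈ S, (d μ : O) * f μ) ^ p ^ a
      = ∑ μ ∈ S, (d μ : O) * f μ ^ p ^ a + p * (r + ∑ μ ∈ S, g μ * f μ ^ p ^ a) := by
    rw [hr, mul_add, Finset.mul_sum, add_comm ((p : O) * r), ← add_assoc, ← Finset.sum_add_distrib]
    congr 1
    refine Finset.sum_congr rfl fun μ _ => ?_
    rw [mul_pow, hg]; ring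
  have h3 := congrArg (algebraMap O ℂ) h2
  simp only [map_pow, map_sum, map_mul, map_add, map_natCast] at h3
  have h4 : ∀ μ ∈ S, algebraMap O ℂ (f μ) = μ := hf
  have h5 : ∀ k : ℕ, ∑ μ ∈ S, (d μ : ℂ) * algebraMap O ℂ (f μ) ^ k = ∑ μ ∈ S, (d μ : ℂ) * μ ^ k :=
    fun k => Finset.sum_congr rfl fun μ hμ => by rw [h4 μ hμ]
  have h6 := h5 1
  simp only [pow_one] at h6
  rw [h5, h6] at h3
  rw [h3]
  congr 2
  have h7 : algebraMap O ℂ (r + ∑ μ ∈ S, g μ * f μ ^ p ^ a) = algebraMap O ℂ r +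
      ∑ μ ∈ S, algebraMap O ℂ (g μ) * algebraMap O ℂ (f μ) ^ p ^ a := by
    simp only [map_pow, map_sum, map_mul, map_add]
  exact h7.symm

theorem exists_int_of_isIntegral_of_rat {x : ℂ} (hx : IsIntegral ℤ x) {q : ℚ} (hq : x = q) :
    ∃ z : ℤ, x = z := by
  subst hq
  have h : IsIntegral ℤ q := by
    rw [show ((q : ℚ) : ℂ) = algebraMap ℚ ℂ q from rfl] at hx
    exact (isIntegral_algebraMap_iff (algebraMap ℚ ℂ).injective).1 hx
  obtain ⟨z, hz⟩ := IsIntegrallyClosed.isIntegral_iff.1 h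
  exact ⟨z, by rw [← hz]; simp⟩

open IntermediateField in
theorem exists_int_trace_of_coprime {V : Type*} [AddCommGroup V] [Module ℂ V]
    [FiniteDimensional ℂ V] (A : Module.End ℂ V) {n : ℕ} (hn : 0 < n) (hA : A ^ n = 1)
    (h : ∀ k : ℕ, k.Coprime n → LinearMap.trace ℂ V (A ^ k) = LinearMap.trace ℂ V A) :
    ∃ z : ℤ, LinearMap.trace ℂ V A = z := by
  have hA' : A ^ (n + 1) = A := by rw [pow_succ, hA, one_mul]
  obtain ⟨S, d, hS, htr⟩ := trace_pow_eq_sum_of_pow_succ_eq A hn hA'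
  have : NeZero n := ⟨hn.ne'⟩
  have hζ : IsPrimitiveRoot (Complex.exp (2 * Real.pi * Complex.I / n)) n :=
    Complex.isPrimitiveRoot_exp n hn.ne'
  set ζ := Complex.exp (2 * Real.pi * Complex.I / n)
  have hζint : IsIntegral ℚ ζ := (hζ.isIntegral hn).tower_top
  have : IsCyclotomicExtension {n} ℚ ℚ⟮ζ⟯ := by
    change IsCyclotomicExtension {n} ℚ (IntermediateField.adjoin ℚ {ζ}).toSubalgebra
    rw [IntermediateField.adjoin_simple_toSubalgebra_of_isAlgebraic hζint.isAlgebraic]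
    exact hζ.adjoin_isCyclotomicExtension ℚ
  have : IsGalois ℚ ℚ⟮ζ⟯ := IsCyclotomicExtension.isGalois {n} ℚ ℚ⟮ζ⟯
  have hfd : FiniteDimensional ℚ ℚ⟮ζ⟯ := IsCyclotomicExtension.finiteDimensional {n} ℚ ℚ⟮ζ⟯
  let K := ℚ⟮ζ⟯
  have hmem : ∀ μ ∈ S, ∃ e : K, (e : ℂ) = μ ∧ (e ^ n = 1 ∨ e = 0) := by
    intro μ hμ
    have h1 := hS μ hμ
    rcases eq_or_ne μ 0 with rfl | h0
    · exact ⟨0, by simp, Or.inr rfl⟩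
    · have h2 : μ ^ n = 1 := by
        rw [pow_succ] at h1
        exact mul_right_cancel₀ h0 (by rw [h1, one_mul])
      obtain ⟨i, -, hi⟩ := hζ.eq_pow_of_pow_eq_one h2
      refine ⟨⟨μ, hi ▸ pow_mem (mem_adjoin_simple_self ℚ ζ) i⟩, rfl, Or.inl ?_⟩
      exact Subtype.ext (by simpa using h2)
  choose! e he using hmem
  let ζ' : K := ⟨ζ, mem_adjoin_simple_self ℚ ζ⟩
  have hζ' : IsPrimitiveRoot ζ' n :=
    IsPrimitiveRoot.of_map_of_injective (f := algebraMap K ℂ) hζ (algebraMap K ℂ).injective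
  let x : K := ∑ μ ∈ S, (d μ : K) * e μ
  have hx : (x : ℂ) = LinearMap.trace ℂ V A := by
    have h1 := htr 1
    simp only [pow_one] at h1
    rw [h1]
    change algebraMap K ℂ x = _
    simp only [x, map_sum, map_mul, map_natCast]
    exact Finset.sum_congr rfl fun μ hμ => by rw [show algebraMap K ℂ (e μ) = μ from (he μ hμ).1]
  have hfix : ∀ σ : K ≃ₐ[ℚ] K, σ x = x := by
    intro σ
    obtain ⟨k, hk⟩ : ∃ k : ℕ, k.Coprime n ∧ σ ζ' = ζ' ^ k := by
      have hs : IsPrimitiveRoot (σ ζ') n := hζ'.map_of_injective σ.injective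
      obtain ⟨i, hi1, hi2, hi3⟩ := (hζ'.isPrimitiveRoot_iff).1 hs
      exact ⟨i, hi2, hi3.symm⟩
    have hk0 : n = 1 ∨ k ≠ 0 := by
      by_cases hk0 : k = 0
      · left; have := hk.1; rw [hk0] at this; simpa using this
      · right; exact hk0
    apply Subtype.ext
    change algebraMap K ℂ (σ x) = (x : ℂ)
    have hkk : ∃ k' : ℕ, k' ≠ 0 ∧ k'.Coprime n ∧ σ ζ' = ζ' ^ k' := by
      rcases hk0 with h1 | h1
      · refine ⟨k + n, by omega, by simpa using hk.1, ?_⟩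
        rw [pow_add, hζ'.pow_eq_one, mul_one, hk.2]
      · exact ⟨k, h1, hk⟩
    obtain ⟨k', hk'0, hk'1, hk'2⟩ := hkk
    have hσ' : ∀ μ ∈ S, σ (e μ) = e μ ^ k' := by
      intro μ hμ
      rcases (he μ hμ).2 with h1 | h1
      · obtain ⟨i, -, hi⟩ := hζ'.eq_pow_of_pow_eq_one h1
        rw [← hi, map_pow, hk'2, ← pow_mul, ← pow_mul, mul_comm]
      · rw [h1, map_zero, zero_pow hk'0]
    rw [hx, ← h k' hk'1, htr]
    simp only [x, map_sum, map_mul, map_natCast]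
    refine Finset.sum_congr rfl fun μ hμ => ?_
    rw [hσ' μ hμ, map_pow, show algebraMap K ℂ (e μ) = μ from (he μ hμ).1]
  obtain ⟨q, hq⟩ := (IsGalois.mem_bot_iff_fixed (F := ℚ) (E := K) x).2 hfix
  refine exists_int_of_isIntegral_of_rat (q := q) (isIntegral_trace_of_pow_succ_eq A hn hA') ?_
  rw [← hx, ← hq]
  simp

section Permutations

open Equiv Equiv.Perm

variable {α : Type*}

theorem minimalPeriod_dvd_orderOf (σ : Perm α) (x : α) :
    Function.minimalPeriod σ x ∣ orderOf σ := by
  apply Function.IsPeriodicPt.minimalPeriod_dvd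
  rw [Function.IsPeriodicPt, Function.IsFixedPt, ← Perm.coe_pow, pow_orderOf_eq_one]; rfl

variable [Fintype α]

theorem minimalPeriod_pos_perm (σ : Perm α) (x : α) : 0 < Function.minimalPeriod σ x := by
  apply Function.minimalPeriod_pos_of_mem_periodicPts
  exact ⟨orderOf σ, orderOf_pos σ, by
    rw [Function.IsPeriodicPt, Function.IsFixedPt, ← Perm.coe_pow, pow_orderOf_eq_one]; rfl⟩

theorem minimalPeriod_pow_perm (σ : Perm α) (k : ℕ) (x : α) :
    Function.minimalPeriod (σ ^ k : Perm α) x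
      = Function.minimalPeriod σ x / Nat.gcd (Function.minimalPeriod σ x) k := by
  rw [Perm.coe_pow]
  apply Function.minimalPeriod_iterate_eq_div_gcd'
  exact Function.minimalPeriod_pos_iff_mem_periodicPts.1 (minimalPeriod_pos_perm σ x)

variable [DecidableEq α]

/-- The minimal period of a moved point is the length of its cycle. -/
theorem minimalPeriod_eq_card_support_cycleOf (σ : Perm α) {x : α} (hx : x ∈ σ.support) :
    Function.minimalPeriod σ x = (σ.cycleOf x).support.card := by
  have hc : (σ.cycleOf x).IsCycle := isCycle_cycleOf σ (mem_support.1 hx)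
  have hper : ∀ n, Function.IsPeriodicPt σ n x ↔ (σ.cycleOf x).support.card ∣ n := by
    intro n
    rw [← hc.orderOf, orderOf_dvd_iff_pow_eq_one,
      hc.pow_eq_one_iff' (x := x) (by simpa using mem_support.1 hx), cycleOf_pow_apply_self]
    rw [Function.IsPeriodicPt, Function.IsFixedPt, ← Perm.coe_pow]
  apply Nat.dvd_antisymm
  · exact ((hper _).2 dvd_rfl).minimalPeriod_dvd
  · exact (hper _).1 (Function.isPeriodicPt_minimalPeriod _ _)

theorem minimalPeriod_eq_one_iff (σ : Perm α) (x : α) :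
    Function.minimalPeriod σ x = 1 ↔ x ∉ σ.support := by
  rw [Function.minimalPeriod_eq_one_iff_isFixedPt, mem_support, not_not]; rfl

/-- The points of minimal period `d` are counted by the parts of size `d`. -/
theorem card_minimalPeriod_eq (σ : Perm α) (d : ℕ) :
    (Finset.univ.filter fun x => Function.minimalPeriod σ x = d).card
      = d * σ.partition.parts.count d := by
  rcases Nat.lt_or_ge d 2 with hd | hd
  · interval_cases d
    · simp [(minimalPeriod_pos_perm σ _).ne']
    · have h1 : σ.cycleType.count 1 = 0 := by
        rw [Multiset.count_eq_zero]
        intro h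
        exact absurd (two_le_of_mem_cycleType h) (by norm_num)
      rw [parts_partition, Multiset.count_add, h1, Multiset.count_replicate_self, zero_add, one_mul]
      simp_rw [minimalPeriod_eq_one_iff]
      rw [← Finset.card_compl]
      congr 1
      ext x
      simp
  · have hrep : (Multiset.replicate (Fintype.card α - σ.support.card) 1).count d = 0 := by
      rw [Multiset.count_eq_zero]
      intro h
      have := Multiset.eq_of_mem_replicate h
      omega
    rw [parts_partition, Multiset.count_add, hrep, add_zero, CycleType.count_def,
      Fintype.card_subtype, mul_comm]
    have hmem : ∀ x, Function.minimalPeriod σ x = d → x ∈ σ.support := by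
      intro x hx
      by_contra h
      rw [(minimalPeriod_eq_one_iff σ x).2 h] at hx
      omega
    rw [Finset.card_eq_sum_card_fiberwise
      (t := σ.cycleFactorsFinset.filter fun c => c.support.card = d) (f := fun x => σ.cycleOf x)]
    · rw [Finset.sum_const_nat (m := d)]
      · congr 1
        refine Finset.card_bij (fun c hc => ⟨c, (Finset.mem_filter.1 hc).1⟩) ?_ ?_ ?_
        · intro c hc
          simpa using (Finset.mem_filter.1 hc).2
        · intro c _ c' _ h
          simpa using h
        · rintro ⟨c, hc⟩ h
          refine ⟨c, Finset.mem_filter.2 ⟨hc, by simpa using h⟩, rfl⟩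
      · intro c hc
        obtain ⟨hc1, hc2⟩ := Finset.mem_filter.1 hc
        rw [← hc2]
        congr 1
        ext x
        simp only [Finset.mem_filter, Finset.mem_univ, true_and]
        constructor
        · rintro ⟨h1, rfl⟩
          rw [mem_support_cycleOf_iff]
          exact ⟨SameCycle.refl _ _, hmem x (by rw [h1, hc2])⟩
        · intro hx
          have h1 : c = σ.cycleOf x := cycle_is_cycleOf hx hc1
          refine ⟨?_, h1.symm⟩
          rw [minimalPeriod_eq_card_support_cycleOf σ, ← h1]
          exact mem_cycleFactorsFinset_support_le hc1 hx
    · intro x hx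
      have hx : Function.minimalPeriod σ x = d := by simpa using hx
      have := hmem x hx
      simp only [Finset.coe_filter, Set.mem_ofPred_eq]
      exact ⟨cycleOf_mem_cycleFactorsFinset_iff.2 this,
        by rw [← minimalPeriod_eq_card_support_cycleOf σ this, hx]⟩

/-- Points counted by a function of the minimal period. -/
theorem card_apply_minimalPeriod_eq (σ : Perm α) (f : ℕ → ℕ) (e : ℕ) :
    (Finset.univ.filter fun x => f (Function.minimalPeriod σ x) = e).card
      = (σ.partition.parts.filter fun d => f d = e).sum := by
  rw [Finset.card_eq_sum_card_fiberwise
      (t := σ.partition.parts.toFinset.filter fun d => f d = e)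
      (f := fun x => Function.minimalPeriod σ x)]
  · rw [Finset.sum_multiset_count, Multiset.toFinset_filter]
    refine Finset.sum_congr rfl fun d hd => ?_
    have hd' := (Finset.mem_filter.1 hd).2
    rw [Multiset.count_filter_of_pos (p := fun d => f d = e) hd', smul_eq_mul, mul_comm, ← card_minimalPeriod_eq,
      Finset.filter_filter]
    congr 1
    ext x
    simp only [Finset.mem_filter, Finset.mem_univ, true_and]
    constructor
    · exact fun h => h.2
    · rintro rfl
      exact ⟨hd', rfl⟩
  · intro x hx
    have hx : f (Function.minimalPeriod σ x) = e := by simpa using hx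
    simp only [Finset.coe_filter, Set.mem_ofPred_eq, Multiset.mem_toFinset]
    refine ⟨?_, hx⟩
    rw [← Multiset.count_pos]
    have h : 0 < Function.minimalPeriod σ x
        * σ.partition.parts.count (Function.minimalPeriod σ x) := by
      rw [← card_minimalPeriod_eq, Finset.card_pos]
      exact ⟨x, by simp⟩
    exact Nat.pos_of_mul_pos_left h

theorem isConj_of_card_minimalPeriod_eq {σ τ : Perm α}
    (h : ∀ d, 0 < d → (Finset.univ.filter fun x => Function.minimalPeriod σ x = d).card
      = (Finset.univ.filter fun x => Function.minimalPeriod τ x = d).card) : IsConj σ τ := by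
  rw [partition_eq_of_isConj, Nat.Partition.ext_iff, Multiset.ext]
  intro d
  rcases Nat.eq_zero_or_pos d with rfl | hd
  · rw [Multiset.count_eq_zero.2, Multiset.count_eq_zero.2]
    · exact fun h => (Nat.lt_irrefl 0 (τ.partition.parts_pos h)).elim
    · exact fun h => (Nat.lt_irrefl 0 (σ.partition.parts_pos h)).elim
  · have := h d hd
    rw [card_minimalPeriod_eq, card_minimalPeriod_eq] at this
    exact Nat.eq_of_mul_eq_mul_left hd this

theorem isConj_pow_of_coprime_orderOf (σ : Perm α) {k : ℕ} (hk : k.Coprime (orderOf σ)) :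
    IsConj (σ ^ k) σ := by
  apply isConj_of_card_minimalPeriod_eq
  intro d _
  congr 1
  ext x
  have : (Function.minimalPeriod σ x).gcd k = 1 :=
    Nat.Coprime.coprime_dvd_left (minimalPeriod_dvd_orderOf σ x) hk.symm
  simp [minimalPeriod_pow_perm, this]

theorem isConj_inv_perm (σ : Perm α) : IsConj σ⁻¹ σ := by
  have h := isConj_pow_of_coprime_orderOf σ (k := orderOf σ - 1) (by
    have := orderOf_pos σ
    rw [Nat.coprime_comm]
    exact (Nat.coprime_self_sub_right this).2 (Nat.coprime_one_right _))
  rwa [show σ ^ (orderOf σ - 1) = σ⁻¹ by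
    rw [eq_inv_iff_mul_eq_one, pow_sub_one_mul (orderOf_pos σ).ne', pow_orderOf_eq_one]] at h

/-- Merging the parts `P` of the cycle type of `σ`, all of the form `m * p ^ j` with `j ≤ a`,
into one part does not change the class of the `p ^ a`-th power. -/
theorem isConj_pow_of_merge_parts {σ τ : Perm α} {P R : Multiset ℕ} {m p k a : ℕ}
    (hp : p.Prime) (hm : m.Coprime p) (hk : k ≤ a)
    (hσ : σ.partition.parts = P + R) (hτ : τ.partition.parts = {m * p ^ k} + R)
    (hsum : P.sum = m * p ^ k) (hP : ∀ d ∈ P, ∃ j ≤ a, d = m * p ^ j) :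
    IsConj (σ ^ p ^ a) (τ ^ p ^ a) := by
  have hdiv : ∀ j ≤ a, m * p ^ j / Nat.gcd (m * p ^ j) (p ^ a) = m := by
    intro j hj
    have h1 : Nat.gcd (m * p ^ j) (p ^ a) = p ^ j := by
      rw [Nat.Coprime.gcd_mul_left_cancel _ (hm.pow_right a)]
      exact Nat.gcd_eq_left (pow_dvd_pow p hj)
    rw [h1, Nat.mul_div_cancel _ (pow_pos hp.pos j)]
  apply isConj_of_card_minimalPeriod_eq
  intro e _
  simp_rw [minimalPeriod_pow_perm]
  have h1 := card_apply_minimalPeriod_eq σ (fun d => d / Nat.gcd d (p ^ a)) e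
  have h2 := card_apply_minimalPeriod_eq τ (fun d => d / Nat.gcd d (p ^ a)) e
  rw [h1, h2, hσ, hτ, Multiset.filter_add, Multiset.filter_add, Multiset.sum_add, Multiset.sum_add]
  congr 1
  by_cases he : m = e
  · rw [Multiset.filter_eq_self.2, Multiset.filter_eq_self.2, hsum, Multiset.sum_singleton]
    · intro d hd
      rw [Multiset.mem_singleton.1 hd, hdiv k hk, he]
    · intro d hd
      obtain ⟨j, hj, rfl⟩ := hP d hd
      rw [hdiv j hj, he]
  · rw [Multiset.filter_eq_nil.2, Multiset.filter_eq_nil.2]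
    · intro d hd
      rwa [Multiset.mem_singleton.1 hd, hdiv k hk]
    · intro d hd
      obtain ⟨j, hj, rfl⟩ := hP d hd
      rwa [hdiv j hj]

/-- Every partition is the cycle type of a permutation. -/
theorem exists_perm_partition_parts {N : ℕ} {M : Multiset ℕ} (hsum : M.sum = N)
    (hpos : ∀ d ∈ M, 0 < d) : ∃ τ : Perm (Fin N), τ.partition.parts = M := by
  have hsplit : M.filter (2 ≤ ·) + M.filter (¬ 2 ≤ ·) = M := Multiset.filter_add_not _ _
  have hone : M.filter (¬ 2 ≤ ·) = Multiset.replicate (M.filter (¬ 2 ≤ ·)).card 1 := by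
    rw [Multiset.eq_replicate_card]
    intro b hb
    have h1 := Multiset.mem_filter.1 hb
    have := hpos b h1.1
    omega
  have hsum' : (M.filter (2 ≤ ·)).sum + (M.filter (¬ 2 ≤ ·)).card = N := by
    rw [← hsum]
    conv_rhs => rw [← hsplit, Multiset.sum_add, hone, Multiset.sum_replicate, smul_eq_mul, mul_one]
  obtain ⟨τ, hτ⟩ := (Equiv.Perm.exists_with_cycleType_iff (Fin N)
    (m := M.filter (2 ≤ ·))).2 ⟨by rw [Fintype.card_fin]; omega,
      fun a ha => (Multiset.mem_filter.1 ha).2⟩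
  refine ⟨τ, ?_⟩
  rw [parts_partition, hτ, ← sum_cycleType, hτ, Fintype.card_fin]
  conv_rhs => rw [← hsplit, hone]
  congr 2
  omega

end Permutations

section Characters

open Equiv

theorem character_eq_of_isConj {G : Type*} [Group G] (V : FDRep ℂ G) {g h : G}
    (hgh : IsConj g h) : V.character g = V.character h := by
  obtain ⟨c, rfl⟩ := isConj_iff.1 hgh
  exact (V.char_conj g c).symm

/-- The characters of the symmetric groups take integer values. -/
theorem exists_int_character {N : ℕ} (V : FDRep ℂ (Perm (Fin N))) (g : Perm (Fin N)) :
    ∃ z : ℤ, V.character g = z := by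
  have hpow : ∀ k, (V.ρ g) ^ k = V.ρ (g ^ k) := fun k => (map_pow V.ρ g k).symm
  refine exists_int_trace_of_coprime (V.ρ g) (n := orderOf g) (orderOf_pos g) ?_ ?_
  · rw [hpow, pow_orderOf_eq_one, map_one]
  · intro k hk
    rw [hpow]
    exact character_eq_of_isConj V (isConj_pow_of_coprime_orderOf g hk)

theorem character_inv {N : ℕ} (V : FDRep ℂ (Perm (Fin N))) (g : Perm (Fin N)) :
    V.character g⁻¹ = V.character g :=
  character_eq_of_isConj V (isConj_inv_perm g)

/-- If suitable `p`-power powers of `g` and `h` are conjugate and a character vanishes at `h`,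
then its value at `g` is divisible by `p`. -/
theorem exists_character_eq_prime_mul {N p a : ℕ} (hp : p.Prime) (V : FDRep ℂ (Perm (Fin N)))
    {g h : Perm (Fin N)} (hgh : IsConj (g ^ p ^ a) (h ^ p ^ a)) (h0 : V.character h = 0) :
    ∃ m : ℤ, V.character g = (p : ℂ) * m := by
  have key : ∀ x : Perm (Fin N), ∃ r : ℂ, IsIntegral ℤ r ∧
      V.character x ^ p ^ a = V.character (x ^ p ^ a) + p * r := by
    intro x
    obtain ⟨r, hr, h⟩ := exists_trace_pow_prime_pow_eq (V.ρ x) (n := orderOf x) (orderOf_pos x)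
      (by rw [← map_pow, pow_orderOf_eq_one, map_one]) hp a
    rw [← map_pow V.ρ] at h
    exact ⟨r, hr, h⟩
  obtain ⟨r, hr, h1⟩ := key g
  obtain ⟨s, hs, h2⟩ := key h
  obtain ⟨z, hz⟩ := exists_int_character V g
  rw [h0, zero_pow (pow_pos hp.pos a).ne', ← character_eq_of_isConj V hgh] at h2
  have hp0 : (p : ℂ) ≠ 0 := by exact_mod_cast hp.ne_zero
  have h3 : (z : ℂ) ^ p ^ a = p * (r - s) := by
    rw [← hz, h1]
    linear_combination -h2
  obtain ⟨o, ho⟩ := exists_int_of_isIntegral_of_rat (hr.sub hs) (q := (z : ℚ) ^ p ^ a / p) (by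
    push_cast
    rw [h3]
    field_simp)
  rw [ho] at h3
  have h4 : z ^ p ^ a = p * o := by exact_mod_cast h3
  obtain ⟨m, hm⟩ := Int.Prime.dvd_pow' hp (Dvd.intro _ h4.symm)
  exact ⟨m, by rw [hz, hm]; push_cast; ring⟩

/-- Bessel's inequality for an orthonormal family of class functions on a finite group. -/
theorem sum_sq_le_card_centralizer {G ι : Type*} [Group G] [Fintype G] [DecidableEq G]
    [DecidableEq ι] (F : Finset ι) (r : ι → G → ℝ) (hconj : ∀ i ∈ F, ∀ g z, r i (z * g * z⁻¹) = r i g)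
    (horth : ∀ i ∈ F, ∀ j ∈ F, ∑ g, r i g * r j g = if i = j then (Fintype.card G : ℝ) else 0)
    (g : G) : ∑ i ∈ F, r i g ^ 2 ≤ ((Finset.univ.filter fun z => z * g = g * z).card : ℝ) := by
  set A := ∑ i ∈ F, r i g ^ 2 with hA
  set c : ℝ := ((Finset.univ.filter fun z => z * g = g * z).card : ℝ) with hc
  set e : G → ℝ := fun y => ∑ z, if z * g * z⁻¹ = y then 1 else 0 with he
  set S : G → ℝ := fun y => ∑ i ∈ F, r i g * r i y with hS
  have hsum : ∀ f : G → ℝ, ∑ y, e y * f y = ∑ z, f (z * g * z⁻¹) := by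
    intro f
    simp_rw [he, Finset.sum_mul]
    rw [Finset.sum_comm]
    refine Finset.sum_congr rfl fun z _ => ?_
    simp
  have hee : ∀ z, e (z * g * z⁻¹) = c := by
    intro z
    rw [hc, Finset.card_filter, Nat.cast_sum, he]
    refine Fintype.sum_equiv (Equiv.mulLeft z⁻¹) _ _ fun w => ?_
    have : w * g * w⁻¹ = z * g * z⁻¹ ↔ z⁻¹ * w * g = g * (z⁻¹ * w) := by
      constructor
      · intro h
        have h' : w * g = z * g * z⁻¹ * w := by rw [← h]; group
        rw [mul_assoc, h']; group
      · intro h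
        have h' : w * g = z * (g * (z⁻¹ * w)) := by rw [← h]; group
        rw [h']; group
    by_cases h : z⁻¹ * w * g = g * (z⁻¹ * w)
    · rw [if_pos (this.2 h), if_pos (by simpa using h), Nat.cast_one]
    · rw [if_neg (mt this.1 h), if_neg (by simpa using h), Nat.cast_zero]
  have h1 : ∑ y, e y * e y = Fintype.card G * c := by
    rw [hsum]
    simp [hee]
  have h2 : ∑ y, e y * S y = Fintype.card G * A := by
    rw [hsum]
    have : ∀ z, S (z * g * z⁻¹) = A := by
      intro z
      rw [hS, hA]
      refine Finset.sum_congr rfl fun i hi => ?_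
      rw [hconj i hi, sq]
    simp [this]
  have h3 : ∑ y, S y * S y = Fintype.card G * A := by
    simp_rw [hS, Finset.sum_mul_sum]
    rw [Finset.sum_comm, hA, Finset.mul_sum]
    refine Finset.sum_congr rfl fun i hi => ?_
    rw [Finset.sum_comm]
    rw [Finset.sum_eq_single_of_mem i hi]
    · have := horth i hi i hi
      rw [if_pos rfl] at this
      rw [← this, Finset.sum_mul]
      exact Finset.sum_congr rfl fun _ _ => by ring
    · intro j hj hji
      have := horth i hi j hj
      rw [if_neg (Ne.symm hji)] at this
      calc ∑ x, r i g * r i x * (r j g * r j x) = r i g * r j g * ∑ x, r i x * r j x := by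
            rw [Finset.mul_sum]; exact Finset.sum_congr rfl fun _ _ => by ring
        _ = 0 := by rw [this, mul_zero]
  have h0 : 0 ≤ ∑ y, (e y - S y) ^ 2 := Finset.sum_nonneg fun _ _ => sq_nonneg _
  have h4 : ∑ y, (e y - S y) ^ 2 = ∑ y, e y * e y - 2 * ∑ y, e y * S y + ∑ y, S y * S y := by
    rw [Finset.mul_sum, ← Finset.sum_sub_distrib, ← Finset.sum_add_distrib]
    exact Finset.sum_congr rfl fun _ _ => by ring
  rw [h4, h1, h2, h3] at h0
  have hG : (0 : ℝ) < Fintype.card G := by exact_mod_cast Fintype.card_pos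
  have : (Fintype.card G : ℝ) * A ≤ Fintype.card G * c := by linarith
  exact le_of_mul_le_mul_left this hG

/-- The irreducible characters of the symmetric group. -/
def irreducibleCharacters (N : ℕ) : Set (Perm (Fin N) → ℂ) :=
  {χ | ∃ V : FDRep ℂ (Perm (Fin N)), Simple V ∧ χ = V.character}

theorem ofReal_re_character {N : ℕ} (V : FDRep ℂ (Perm (Fin N))) (g : Perm (Fin N)) :
    (((V.character g).re : ℝ) : ℂ) = V.character g := by
  obtain ⟨z, hz⟩ := exists_int_character V g
  rw [hz]
  simp

theorem sum_re_mul_re_of_mem_irreducibleCharacters {N : ℕ} {χ ψ : Perm (Fin N) → ℂ}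
    (hχ : χ ∈ irreducibleCharacters N) (hψ : ψ ∈ irreducibleCharacters N) [Decidable (χ = ψ)] :
    ∑ g, (χ g).re * (ψ g).re = if χ = ψ then (Fintype.card (Perm (Fin N)) : ℝ) else 0 := by
  obtain ⟨V, hV, rfl⟩ := hχ
  obtain ⟨W, hW, rfl⟩ := hψ
  have hG : (Nat.card (Perm (Fin N)) : ℂ) ≠ 0 := by
    exact_mod_cast Nat.card_pos.ne'
  have : Invertible (Nat.card (Perm (Fin N)) : ℂ) := invertibleOfNonzero hG
  have h := FDRep.char_orthonormal V W
  have h1 : ∑ g, V.character g * W.character g⁻¹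
      = ((∑ g, (V.character g).re * (W.character g).re : ℝ) : ℂ) := by
    push_cast
    refine Finset.sum_congr rfl fun g _ => ?_
    rw [ofReal_re_character, ofReal_re_character, character_inv]
  rw [h1, inv_mul_eq_iff_eq_mul₀ hG] at h
  split_ifs with heq
  · have hne : ∑ g, (V.character g).re * (W.character g).re ≠ 0 := by
      intro h0
      rw [← heq] at h h0
      have h2 := FDRep.char_orthonormal V V
      rw [if_pos ⟨Iso.refl V⟩, inv_mul_eq_iff_eq_mul₀ hG] at h2
      have h3 : ∑ g, V.character g * V.character g⁻¹
          = ((∑ g, (V.character g).re * (V.character g).re : ℝ) : ℂ) := by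
        push_cast
        refine Finset.sum_congr rfl fun g _ => ?_
        rw [ofReal_re_character, character_inv]
      rw [h3, h0] at h2
      rw [Complex.ofReal_zero] at h2
      exact hG (by simpa using h2.symm)
    split_ifs at h with hiso
    · rw [mul_one, ← Complex.ofReal_natCast] at h
      rw [Complex.ofReal_injective h, Nat.card_eq_fintype_card]
    · rw [mul_zero] at h
      exact absurd (by exact_mod_cast h) hne
  · rw [if_neg, mul_zero] at h
    · exact_mod_cast h
    · rintro ⟨i⟩
      exact heq (FDRep.char_iso i)

theorem sum_sq_re_le_card_centralizer {N : ℕ} {F : Finset (Perm (Fin N) → ℂ)}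
    (hF : ∀ χ ∈ F, χ ∈ irreducibleCharacters N) (g : Perm (Fin N)) :
    ∑ χ ∈ F, (χ g).re ^ 2 ≤ ((Finset.univ.filter fun z => z * g = g * z).card : ℝ) := by
  classical
  refine sum_sq_le_card_centralizer F (fun χ g => (χ g).re) ?_ ?_ g
  · intro χ hχ g z
    obtain ⟨V, -, rfl⟩ := hF χ hχ
    simp only [V.char_conj]
  · intro χ hχ ψ hψ
    exact sum_re_mul_re_of_mem_irreducibleCharacters (hF χ hχ) (hF ψ hψ)

theorem card_conjClasses_perm_le (N : ℕ) :
    Nat.card (ConjClasses (Perm (Fin N))) ≤ Fintype.card (Nat.Partition N) := by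
  rw [← Nat.card_eq_fintype_card]
  have e : Nat.Partition (Fintype.card (Fin N)) ≃ Nat.Partition N :=
    Equiv.cast (by rw [Fintype.card_fin])
  rw [← Nat.card_congr e]
  refine Nat.card_le_card_of_injective
    (Quotient.lift Equiv.Perm.partition
      (fun a b h => Equiv.Perm.partition_eq_of_isConj.1 h)) ?_
  rintro ⟨a⟩ ⟨b⟩ h
  exact Quotient.sound (Equiv.Perm.partition_eq_of_isConj.2 h)

theorem card_le_of_subset_irreducibleCharacters {N : ℕ} {F : Finset (Perm (Fin N) → ℂ)}
    (hF : ∀ χ ∈ F, χ ∈ irreducibleCharacters N) : F.card ≤ Fintype.card (Nat.Partition N) := by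
  classical
  refine le_trans ?_ (card_conjClasses_perm_le N)
  have h1 : ∑ g : Perm (Fin N), ∑ χ ∈ F, (χ g).re ^ 2
      = F.card * (Fintype.card (Perm (Fin N)) : ℝ) := by
    rw [Finset.sum_comm]
    rw [← nsmul_eq_mul, ← Finset.sum_const]
    refine Finset.sum_congr rfl fun χ hχ => ?_
    have := sum_re_mul_re_of_mem_irreducibleCharacters (hF χ hχ) (hF χ hχ)
    rw [if_pos rfl] at this
    rw [← this]
    exact Finset.sum_congr rfl fun _ _ => sq _
  have h2 : ∑ g : Perm (Fin N), ((Finset.univ.filter fun z => z * g = g * z).card : ℝ)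
      = Nat.card (ConjClasses (Perm (Fin N))) * (Fintype.card (Perm (Fin N)) : ℝ) := by
    rw [← Nat.card_eq_fintype_card (α := Perm (Fin N)), ← Nat.cast_mul,
      ← card_comm_eq_card_conjClasses_mul_card, Nat.card_eq_fintype_card, Fintype.card_subtype,
      ← Nat.cast_sum]
    congr 1
    rw [← Finset.univ_product_univ, Finset.card_filter, Finset.sum_product]
    refine Finset.sum_congr rfl fun g _ => ?_
    rw [Finset.card_filter]
    exact Finset.sum_congr rfl fun z _ => by simp only [Commute, SemiconjBy, eq_comm (a := g * z)]
  have h3 := Finset.sum_le_sum fun (g : Perm (Fin N)) (_ : g ∈ Finset.univ) =>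
    sum_sq_re_le_card_centralizer hF g
  rw [h1, h2] at h3
  have hG : (0 : ℝ) < Fintype.card (Perm (Fin N)) := by exact_mod_cast Fintype.card_pos
  exact_mod_cast le_of_mul_le_mul_right h3 hG

theorem finite_irreducibleCharacters (N : ℕ) : (irreducibleCharacters N).Finite := by
  by_contra h
  obtain ⟨F, hF, hcard⟩ := Set.Infinite.exists_subset_card_eq h (Fintype.card (Nat.Partition N) + 1)
  have := card_le_of_subset_irreducibleCharacters (F := F) fun χ hχ => hF hχ
  omega

end Characters

section CycleRestriction

open Equiv

/-- The average of the trace over a coset of a finite group commuting with `c` is an algebraic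
integer. -/
theorem isIntegral_inv_card_mul_sum_trace {G H W : Type*} [Group G] [Group H] [Fintype H]
    [AddCommGroup W] [Module ℂ W] [FiniteDimensional ℂ W] (ρ : Representation ℂ G W)
    (f : H →* G) {c : G} {n : ℕ} (hn : 0 < n) (hc : c ^ n = 1) (hcomm : ∀ h, Commute c (f h)) :
    IsIntegral ℤ ((Fintype.card H : ℂ)⁻¹ * ∑ h, LinearMap.trace ℂ W (ρ (c * f h))) := by
  have hH : (Fintype.card H : ℂ) ≠ 0 := by exact_mod_cast Fintype.card_pos.ne'
  set P : Module.End ℂ W := (Fintype.card H : ℂ)⁻¹ • ∑ h, ρ (f h) with hP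
  have hinv : ∀ h, ρ (f h) * P = P := by
    intro h
    rw [hP, mul_smul_comm, Finset.mul_sum]
    congr 1
    refine Fintype.sum_equiv (Equiv.mulLeft h) _ _ fun x => ?_
    rw [← map_mul, ← map_mul]
    rfl
  have hPP : P * P = P := by
    conv_lhs => enter [1]; rw [hP]
    rw [smul_mul_assoc, Finset.sum_mul, Finset.sum_congr rfl fun h _ => hinv h, Finset.sum_const,
      Finset.card_univ, ← Nat.cast_smul_eq_nsmul ℂ, smul_smul, inv_mul_cancel₀ hH, one_smul]
  have hPc : Commute (ρ c) P := by
    rw [hP]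
    refine Commute.smul_right (Commute.sum_right _ _ _ fun h _ => ?_) _
    exact (hcomm h).map ρ
  have hpow : (ρ c * P) ^ (n + 1) = ρ c * P := by
    rw [hPc.mul_pow, ← map_pow, pow_succ c, hc, one_mul]
    congr 1
    exact (show IsIdempotentElem P from hPP).pow_succ_eq n
  have h := isIntegral_trace_of_pow_succ_eq (ρ c * P) hn hpow
  have heq : ρ c * P = (Fintype.card H : ℂ)⁻¹ • ∑ h, ρ (c * f h) := by
    rw [hP, mul_smul_comm, Finset.mul_sum]
    simp_rw [map_mul]
  rwa [heq, map_smul, map_sum, smul_eq_mul] at h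

theorem card_le_sum_sq_character {N : ℕ} {H : Type*} [Group H] [Fintype H]
    (V : FDRep ℂ (Perm (Fin N))) (f : H →* Perm (Fin N)) {c : Perm (Fin N)}
    (hcomm : ∀ h, Commute c (f h)) (hne : ∃ h, V.character (c * f h) ≠ 0) :
    (Fintype.card H : ℝ) ≤ ∑ h, (V.character (c * f h)).re ^ 2 := by
  have hH : (0 : ℝ) < Fintype.card H := by exact_mod_cast Fintype.card_pos
  choose z hz using exists_int_character V
  have hsum : ∀ h, (V.character (c * f h)).re ^ 2 = ((z (c * f h)) ^ 2 : ℤ) := by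
    intro h
    rw [hz]
    simp
  have hInt := isIntegral_inv_card_mul_sum_trace
    (Representation.linHom V.ρ V.ρ) f (orderOf_pos c) (pow_orderOf_eq_one c) hcomm
  have htr : ∀ h, LinearMap.trace ℂ _ (Representation.linHom V.ρ V.ρ (c * f h))
      = (((z (c * f h)) ^ 2 : ℤ) : ℂ) := by
    intro h
    have := FDRep.char_linHom V V (c * f h)
    rw [character_inv, hz] at this
    rw [sq]
    push_cast
    exact this
  simp_rw [htr, ← Int.cast_sum] at hInt
  obtain ⟨o, ho⟩ := exists_int_of_isIntegral_of_rat hInt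
    (q := (Fintype.card H : ℚ)⁻¹ * ((∑ h, (z (c * f h)) ^ 2 : ℤ) : ℚ)) (by push_cast; rfl)
  simp_rw [hsum, ← Int.cast_sum]
  have h1 : (∑ h, (z (c * f h)) ^ 2 : ℤ) = Fintype.card H * o := by
    have hH' : (Fintype.card H : ℂ) ≠ 0 := by exact_mod_cast Fintype.card_pos.ne'
    rw [inv_mul_eq_iff_eq_mul₀ hH'] at ho
    exact_mod_cast ho
  have h2 : 0 < (∑ h, (z (c * f h)) ^ 2 : ℤ) := by
    obtain ⟨h, hh⟩ := hne
    refine Finset.sum_pos' (fun _ _ => sq_nonneg _) ⟨h, Finset.mem_univ _, ?_⟩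
    rw [hz] at hh
    have : z (c * f h) ≠ 0 := by exact_mod_cast hh
    positivity
  rw [h1] at h2 ⊢
  have h3 : 0 < o := by
    by_contra hcon
    have : (Fintype.card H : ℤ) * o ≤ 0 :=
      mul_nonpos_of_nonneg_of_nonpos (by positivity) (not_lt.1 hcon)
    omega
  have h4 : (Fintype.card H : ℤ) ≤ Fintype.card H * o :=
    le_mul_of_one_le_right (by positivity) h3
  exact_mod_cast h4

/-- Summing a function of the cycle type against the centralizer orders. -/
theorem sum_partition_mul_card_centralizer_le {α : Type*} [Fintype α] [DecidableEq α]
    (F : Nat.Partition (Fintype.card α) → ℕ) :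
    ∑ h : Perm α, F h.partition * (Finset.univ.filter fun z => z * h = h * z).card
      ≤ Fintype.card (Perm α) * ∑ ν, F ν := by
  have hcent : ∀ h : Perm α, (Finset.univ.filter fun z => z * h = h * z).card
      = Nat.card (Subgroup.centralizer {h}) := by
    intro h
    rw [← Fintype.card_subtype, ← Nat.card_eq_fintype_card]
    refine Nat.card_congr (Equiv.subtypeEquivRight fun z => ?_)
    rw [Subgroup.mem_centralizer_singleton_iff]
  rw [← Finset.sum_fiberwise (g := fun h : Perm α => h.partition), Finset.mul_sum]
  refine Finset.sum_le_sum fun ν _ => ?_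
  rcases (Finset.univ.filter fun h : Perm α => h.partition = ν).eq_empty_or_nonempty with he | ⟨g, hg⟩
  · rw [he]; simp
  · have hg' : g.partition = ν := by simpa using hg
    have hterm : ∀ h ∈ Finset.univ.filter fun h : Perm α => h.partition = ν,
        F h.partition * (Finset.univ.filter fun z => z * h = h * z).card
          = F ν * Nat.card (Subgroup.centralizer {g}) := by
      intro h hh
      have hh' : h.partition = ν := by simpa using hh
      have hct : h.cycleType = g.cycleType := by
        rw [← Equiv.Perm.isConj_iff_cycleType_eq, Equiv.Perm.partition_eq_of_isConj, hh', hg']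
      rw [hh', hcent, Equiv.Perm.nat_card_centralizer, Equiv.Perm.nat_card_centralizer, hct]
    rw [Finset.sum_congr rfl hterm, Finset.sum_const, smul_eq_mul]
    have h1 := Equiv.Perm.card_isConj_mul_eq g
    rw [← Equiv.Perm.nat_card_centralizer] at h1
    have h2 : (Finset.univ.filter fun h : Perm α => h.partition = ν).card
        = Nat.card {h : Perm α | IsConj g h} := by
      rw [← Fintype.card_subtype, ← Nat.card_eq_fintype_card]
      refine Nat.card_congr (Equiv.subtypeEquivRight fun z => ?_)
      rw [Set.mem_ofPred_eq, Equiv.Perm.partition_eq_of_isConj, hg', eq_comm]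
    rw [h2, Fintype.card_perm, ← h1]
    apply le_of_eq
    ring

/-- The centralizer of a product of a cycle of length `t` with a permutation fixing its support. -/
theorem card_centralizer_cycle_mul {α : Type*} [Fintype α] [DecidableEq α] {c : Perm α}
    (hc : c.IsCycle) (h : Perm {x // x ∉ c.support}) :
    (Finset.univ.filter fun z => z * (c * Perm.ofSubtype h) = (c * Perm.ofSubtype h) * z).card
      = c.support.card * ((1 + h.partition.parts.count c.support.card)
        * (Finset.univ.filter fun z => z * h = h * z).card) := by
  have hcent : ∀ {β : Type _} [Fintype β] [DecidableEq β] (h : Perm β),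
      (Finset.univ.filter fun z => z * h = h * z).card
      = Nat.card (Subgroup.centralizer {h}) := by
    intro β _ _ h
    rw [← Fintype.card_subtype, ← Nat.card_eq_fintype_card]
    refine Nat.card_congr (Equiv.subtypeEquivRight fun z => ?_)
    rw [Subgroup.mem_centralizer_singleton_iff]
  have hdisj : Perm.Disjoint c (Perm.ofSubtype h) := by
    intro x
    by_cases hx : x ∈ c.support
    · right
      exact Perm.ofSubtype_apply_of_not_mem h (by simpa using hx)
    · left
      simpa using hx
  set t := c.support.card with ht
  have ht2 : 2 ≤ t := hc.two_le_card_support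
  have hct : (c * Perm.ofSubtype h).cycleType = t ::ₘ h.cycleType := by
    rw [hdisj.cycleType_mul, hc.cycleType, Perm.cycleType_ofSubtype]
    rfl
  have hcard : Fintype.card α = t + Fintype.card {x // x ∉ c.support} := by
    rw [Fintype.card_subtype_compl, Fintype.card_coe]
    have := Finset.card_le_univ c.support
    omega
  have hcount : h.partition.parts.count t = h.cycleType.count t := by
    rw [Perm.parts_partition, Multiset.count_add, add_eq_left, Multiset.count_eq_zero]
    intro hmem
    have := Multiset.eq_of_mem_replicate hmem
    omega
  rw [hcent, hcent, Perm.nat_card_centralizer, Perm.nat_card_centralizer, hct, hcount, hcard,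
    Multiset.sum_cons, Multiset.prod_cons, Nat.add_sub_add_left]
  have hprod : ∏ n ∈ (t ::ₘ h.cycleType).toFinset, ((t ::ₘ h.cycleType).count n).factorial
      = (1 + h.cycleType.count t) * ∏ n ∈ h.cycleType.toFinset, (h.cycleType.count n).factorial := by
    have hins : (t ::ₘ h.cycleType).toFinset = insert t h.cycleType.toFinset := by simp
    have h1 : ∏ n ∈ h.cycleType.toFinset, (h.cycleType.count n).factorial
        = ∏ n ∈ insert t h.cycleType.toFinset, (h.cycleType.count n).factorial := by
      refine Finset.prod_subset (Finset.subset_insert _ _) fun x _ hx => ?_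
      rw [Multiset.count_eq_zero.2 (by simpa using hx), Nat.factorial_zero]
    rw [h1, hins, ← Finset.mul_prod_erase _ _ (Finset.mem_insert_self t _),
      ← Finset.mul_prod_erase _ (fun n => (h.cycleType.count n).factorial)
        (Finset.mem_insert_self t _), Multiset.count_cons_self, Nat.factorial_succ, ← mul_assoc,
        add_comm 1]
    congr 1
    refine Finset.prod_congr rfl fun x hx => ?_
    rw [Multiset.count_cons_of_ne (Finset.ne_of_mem_erase hx)]
  rw [hprod]
  ring

/-- The number of irreducible characters not vanishing at a permutation with a cycle of
length `t`. -/
theorem card_nonvanishing_characters_le {N t : ℕ} (ht : 2 ≤ t) {g : Perm (Fin N)}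
    (hg : t ∈ g.partition.parts) {F : Finset (Perm (Fin N) → ℂ)}
    (hF : ∀ χ ∈ F, χ ∈ irreducibleCharacters N ∧ χ g ≠ 0) :
    F.card ≤ t * ∑ ν : Nat.Partition (N - t), (1 + ν.parts.count t) := by
  classical
  have hmem : t ∈ g.cycleType := by
    rw [← Perm.filter_parts_partition_eq_cycleType]
    exact Multiset.mem_filter.2 ⟨hg, ht⟩
  obtain ⟨c, s, hcs, hdis, hcyc, hcard⟩ := Perm.mem_cycleType_iff.1 hmem
  have hfix : ∀ x, x ∉ c.support ↔ s x ∉ c.support := by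
    intro x
    have hs : ∀ y, y ∈ c.support → s y = y := fun y hy =>
      (hdis y).resolve_left (Perm.mem_support.1 hy)
    constructor
    · intro hx hsx
      have := hs _ hsx
      rw [s.injective this] at hsx
      exact hx hsx
    · intro hx hsx
      rw [hs x hsx] at hx
      exact hx hsx
  have hs_eq : Perm.ofSubtype (s.subtypePerm (p := fun x => x ∉ c.support) (fun x => (hfix x).symm)) = s := by
    apply Perm.ofSubtype_subtypePerm
    intro x hx hxc
    exact hx ((hdis x).resolve_left (Perm.mem_support.1 hxc))
  let f : Perm {x // x ∉ c.support} →* Perm (Fin N) := Perm.ofSubtype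
  have hcomm : ∀ h, Commute c (f h) := by
    intro h
    refine Perm.Disjoint.commute fun x => ?_
    by_cases hx : x ∈ c.support
    · right
      exact Perm.ofSubtype_apply_of_not_mem h (by simpa using hx)
    · left
      simpa using hx
  have hH : 0 < Fintype.card (Perm {x // x ∉ c.support}) := Fintype.card_pos
  have hsub : Fintype.card {x // x ∉ c.support} = N - t := by
    rw [Fintype.card_subtype_compl, Fintype.card_coe, Fintype.card_fin, hcard]
  have h1 : (F.card : ℝ) * Fintype.card (Perm {x // x ∉ c.support})
      ≤ ∑ χ ∈ F, ∑ h, (χ (c * f h)).re ^ 2 := by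
    rw [← nsmul_eq_mul, ← Finset.sum_const]
    refine Finset.sum_le_sum fun χ hχ => ?_
    obtain ⟨⟨V, hV, rfl⟩, hne⟩ := hF χ hχ
    refine card_le_sum_sq_character V f hcomm
      ⟨s.subtypePerm (p := fun x => x ∉ c.support) (fun x => (hfix x).symm), ?_⟩
    change V.character (c * Perm.ofSubtype _) ≠ 0
    rwa [hs_eq, ← hcs]
  have h2 : ∑ χ ∈ F, ∑ h, (χ (c * f h)).re ^ 2
      ≤ ∑ h, ((Finset.univ.filter fun z => z * (c * f h) = (c * f h) * z).card : ℝ) := by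
    rw [Finset.sum_comm]
    exact Finset.sum_le_sum fun h _ => sum_sq_re_le_card_centralizer (fun χ hχ => (hF χ hχ).1) _
  have h3 : ∑ h, (Finset.univ.filter fun z => z * (c * f h) = (c * f h) * z).card
      ≤ t * (Fintype.card (Perm {x // x ∉ c.support})
        * ∑ ν : Nat.Partition (Fintype.card {x // x ∉ c.support}), (1 + ν.parts.count t)) := by
    rw [Finset.sum_congr rfl fun h _ => card_centralizer_cycle_mul hcyc h, hcard, ← Finset.mul_sum]
    exact Nat.mul_le_mul_left _
      (sum_partition_mul_card_centralizer_le fun ν => 1 + ν.parts.count t)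
  rw [hsub] at h3
  have h4 : F.card * Fintype.card (Perm {x // x ∉ c.support})
      ≤ t * (Fintype.card (Perm {x // x ∉ c.support})
        * ∑ ν : Nat.Partition (N - t), (1 + ν.parts.count t)) := by
    refine le_trans ?_ h3
    exact_mod_cast h1.trans h2
  rw [mul_left_comm, mul_comm F.card] at h4
  exact Nat.le_of_mul_le_mul_left h4 hH

/-- Recursion for the total number of parts of size `t`. -/
theorem sum_one_add_count_parts {n t : ℕ} (ht : 1 ≤ t) (htn : t ≤ n) :
    ∑ ν : Nat.Partition n, (1 + ν.parts.count t)
      = Fintype.card (Nat.Partition n) + ∑ ν : Nat.Partition (n - t), (1 + ν.parts.count t) := by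
  rw [Finset.sum_add_distrib]
  congr 1
  · simp
  · have h1 : ∑ ν : {ν : Nat.Partition n // t ∈ ν.parts}, ν.1.parts.count t
        = ∑ ν : Nat.Partition (n - t), (1 + ν.parts.count t) := by
      refine Fintype.sum_equiv (Nat.Partition.partitionWithPartEquiv ht htn) _ _ fun ν => ?_
      obtain ⟨μ, rfl⟩ := (Nat.Partition.partitionWithPartEquiv ht htn).symm.surjective ν
      rw [Nat.Partition.partitionWithPartEquiv_symm_apply_parts, Multiset.count_cons_self,
        add_comm, Equiv.apply_symm_apply]
    rw [← h1, ← Finset.sum_subtype (Finset.univ.filter fun ν : Nat.Partition n => t ∈ ν.parts)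
      (by simp) (fun ν => ν.parts.count t), Finset.sum_filter_of_ne]
    intro ν _ h
    exact Multiset.count_ne_zero.1 h

theorem sum_one_add_count_parts_of_lt {n t : ℕ} (htn : n < t) :
    ∑ ν : Nat.Partition n, (1 + ν.parts.count t) = Fintype.card (Nat.Partition n) := by
  have : ∀ ν : Nat.Partition n, ν.parts.count t = 0 := by
    intro ν
    rw [Multiset.count_eq_zero]
    intro h
    have := Multiset.le_sum_of_mem h
    rw [ν.parts_sum] at this
    omega
  simp [this]

end CycleRestriction

section CountingEntries

open Equiv

/-- The multiset of parts contains a family of parts `m * p ^ j` with sum `m * p ^ k ≥ s`. -/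
def HasMergeableParts (p s : ℕ) (M : Multiset ℕ) : Prop :=
  ∃ m k : ℕ, ∃ P R : Multiset ℕ, m.Coprime p ∧ M = P + R ∧ P.sum = m * p ^ k ∧
    s ≤ m * p ^ k ∧ ∀ d ∈ P, ∃ j ≤ k, d = m * p ^ j

theorem card_indivisible_le {N p s : ℕ} {B : ℝ} (hp : p.Prime) (hs : 2 ≤ s)
    (hB : ∀ t, s ≤ t → t ≤ N →
      (t : ℝ) * ∑ ν : Nat.Partition (N - t), (1 + (ν.parts.count t : ℝ)) ≤ B)
    {g : Perm (Fin N)} (hg : HasMergeableParts p s g.partition.parts)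
    {F : Finset (Perm (Fin N) → ℂ)}
    (hF : ∀ χ ∈ F, χ ∈ irreducibleCharacters N ∧ ¬ ∃ m : ℤ, χ g = (p : ℂ) * m) :
    (F.card : ℝ) ≤ B := by
  obtain ⟨m, k, P, R, hm, hPR, hsum, hle, hP⟩ := hg
  have htot : (m * p ^ k) + R.sum = N := by
    have := g.partition.parts_sum
    rw [hPR, Multiset.sum_add, hsum, Fintype.card_fin] at this
    exact this
  obtain ⟨τ, hτ⟩ := exists_perm_partition_parts (M := {m * p ^ k} + R) (N := N)
    (by rw [Multiset.sum_add, Multiset.sum_singleton, htot]) (by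
      intro d hd
      rcases Multiset.mem_add.1 hd with h | h
      · rw [Multiset.mem_singleton.1 h]
        omega
      · exact g.partition.parts_pos (by rw [hPR]; exact Multiset.mem_add.2 (Or.inr h)))
  have hconj := isConj_pow_of_merge_parts hp hm le_rfl hPR hτ hsum hP
  have hne : ∀ χ ∈ F, χ ∈ irreducibleCharacters N ∧ χ τ ≠ 0 := by
    intro χ hχ
    refine ⟨(hF χ hχ).1, fun h0 => ?_⟩
    obtain ⟨⟨V, hV, rfl⟩, hnd⟩ := hF χ hχ
    exact hnd (exists_character_eq_prime_mul hp V hconj h0)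
  have h1 := card_nonvanishing_characters_le (t := m * p ^ k) (by omega) (g := τ)
    (by rw [hτ]; exact Multiset.mem_add.2 (Or.inl (Multiset.mem_singleton_self _))) hne
  have h2 := hB (m * p ^ k) hle (by omega)
  refine le_trans ?_ h2
  have h3 : (F.card : ℝ) ≤ ((m * p ^ k * ∑ ν : Nat.Partition (N - m * p ^ k),
    (1 + ν.parts.count (m * p ^ k)) : ℕ) : ℝ) := by exact_mod_cast h1
  push_cast at h3 ⊢
  exact h3

/-- The number of character table entries not divisible by `p` is controlled by the number of
partitions without mergeable parts and by the number of characters not vanishing on long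
cycles. -/
theorem ncard_indivisible_entries_le {N p s : ℕ} {B : ℝ} (hp : p.Prime) (hs : 2 ≤ s)
    (hB0 : 0 ≤ B)
    (hB : ∀ t, s ≤ t → t ≤ N →
      (t : ℝ) * ∑ ν : Nat.Partition (N - t), (1 + (ν.parts.count t : ℝ)) ≤ B) :
    (Set.ncard {χc : (Perm (Fin N) → ℂ) × ConjClasses (Perm (Fin N)) |
          (∃ V : FDRep ℂ (Perm (Fin N)), Simple V ∧ χc.1 = V.character) ∧
          ∀ g : Perm (Fin N), ConjClasses.mk g = χc.2 →
            ¬ ∃ m : ℤ, χc.1 g = (p : ℂ) * (m : ℂ)} : ℝ)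
      ≤ Fintype.card (Nat.Partition N) *
          (Nat.card {ν : Nat.Partition N // ¬ HasMergeableParts p s ν.parts})
        + Fintype.card (Nat.Partition N) * B := by
  classical
  set I := (finite_irreducibleCharacters N).toFinset with hI
  have hmemI : ∀ χ, χ ∈ I ↔ χ ∈ irreducibleCharacters N := fun χ => by simp [hI]
  set K : ConjClasses (Perm (Fin N)) → Finset (Perm (Fin N) → ℂ) := fun c =>
    I.filter fun χ => ∀ g, ConjClasses.mk g = c → ¬ ∃ m : ℤ, χ g = (p : ℂ) * (m : ℂ) with hK
  let _ : Fintype (ConjClasses (Perm (Fin N))) := Fintype.ofFinite _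
  have hset : {χc : (Perm (Fin N) → ℂ) × ConjClasses (Perm (Fin N)) |
          (∃ V : FDRep ℂ (Perm (Fin N)), Simple V ∧ χc.1 = V.character) ∧
          ∀ g : Perm (Fin N), ConjClasses.mk g = χc.2 →
            ¬ ∃ m : ℤ, χc.1 g = (p : ℂ) * (m : ℂ)}
      = ↑((Finset.univ.sigma K).image fun x => (x.2, x.1)) := by
    ext ⟨χ, c⟩
    simp only [Set.mem_ofPred_eq, Finset.coe_image, Set.mem_image, Finset.mem_coe,
      Finset.mem_sigma, Finset.mem_univ, true_and, Sigma.exists, Prod.mk.injEq]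
    constructor
    · rintro ⟨h1, h2⟩
      exact ⟨c, χ, Finset.mem_filter.2 ⟨(hmemI χ).2 h1, h2⟩, rfl, rfl⟩
    · rintro ⟨c', χ', h, rfl, rfl⟩
      obtain ⟨h1, h2⟩ := Finset.mem_filter.1 h
      exact ⟨(hmemI _).1 h1, h2⟩
  have hcardI : ∀ c, ((K c).card : ℝ) ≤ Fintype.card (Nat.Partition N) := fun c => by
    exact_mod_cast card_le_of_subset_irreducibleCharacters fun χ hχ =>
      (hmemI χ).1 (Finset.mem_filter.1 hχ).1
  set good : ConjClasses (Perm (Fin N)) → Prop := fun c =>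
    HasMergeableParts p s (Quotient.out c : Perm (Fin N)).partition.parts with hgood
  have hout : ∀ c : ConjClasses (Perm (Fin N)), ConjClasses.mk (Quotient.out c) = c :=
    fun c => Quotient.out_eq c
  have hcardgood : ∀ c, good c → ((K c).card : ℝ) ≤ B := by
    intro c hc
    refine card_indivisible_le hp hs hB hc fun χ hχ => ?_
    obtain ⟨h1, h2⟩ := Finset.mem_filter.1 hχ
    exact ⟨(hmemI χ).1 h1, h2 _ (hout c)⟩
  have hcast : ∀ n, n = N → ∀ Q : Multiset ℕ → Prop,
      Nat.card {ν : Nat.Partition n // Q ν.parts} = Nat.card {ν : Nat.Partition N // Q ν.parts} := by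
    rintro n rfl Q
    rfl
  have hbad : (Finset.univ.filter fun c => ¬ good c).card
      ≤ Nat.card {ν : Nat.Partition N // ¬ HasMergeableParts p s ν.parts} := by
    rw [← hcast _ (Fintype.card_fin N) fun M => ¬ HasMergeableParts p s M, ← Fintype.card_subtype, ← Nat.card_eq_fintype_card]
    refine Nat.card_le_card_of_injective (fun c => ⟨(Quotient.out c.1 : Perm (Fin N)).partition, c.2⟩) ?_
    rintro ⟨a, ha⟩ ⟨b, hb⟩ h
    have h' : (Quotient.out a : Perm (Fin N)).partition = (Quotient.out b : Perm (Fin N)).partition := by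
      simpa using h
    have := ConjClasses.mk_eq_mk_iff_isConj.2 (Perm.partition_eq_of_isConj.2 h')
    rw [hout, hout] at this
    exact Subtype.ext this
  rw [hset, Set.ncard_coe_finset, Finset.card_image_of_injective, Finset.card_sigma, Nat.cast_sum,
    ← Finset.sum_filter_not_add_sum_filter _ good]
  · refine add_le_add ?_ ?_
    · refine (Finset.sum_le_card_nsmul _ _ _ fun c _ => hcardI c).trans ?_
      rw [nsmul_eq_mul, mul_comm]
      gcongr
    · refine (Finset.sum_le_card_nsmul _ _ _ fun c hc => hcardgood c (Finset.mem_filter.1 hc).2).trans ?_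
      rw [nsmul_eq_mul]
      gcongr
      refine (Finset.card_filter_le _ _).trans ?_
      rw [Finset.card_univ, ← Nat.card_eq_fintype_card]
      exact card_conjClasses_perm_le N
  · rintro ⟨a, b⟩ ⟨c, d⟩ h
    simp only [Prod.mk.injEq] at h
    obtain ⟨rfl, rfl⟩ := h
    rfl

/-- If `p(N - s)` decays geometrically, then so does the total number of parts of size `t`,
counted over the partitions of `N - s`. -/
theorem sum_one_add_count_parts_le {N t : ℕ} {K q : ℝ} (hK : 0 ≤ K) (hq0 : 0 < q) (hq1 : q < 1)
    (ht : 1 ≤ t) (h : ∀ s ≤ N, (Fintype.card (Nat.Partition (N - s)) : ℝ) ≤ K * q ^ s) {s : ℕ}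
    (hs : s ≤ N) :
    ∑ ν : Nat.Partition (N - s), (1 + (ν.parts.count t : ℝ)) ≤ K * q ^ s / (1 - q ^ t) := by
  have hqt : q ^ t < 1 := pow_lt_one₀ hq0.le hq1 (by omega)
  have hpos : 0 < 1 - q ^ t := by linarith
  have hcast : ∀ n, ∑ ν : Nat.Partition n, (1 + (ν.parts.count t : ℝ))
      = ((∑ ν : Nat.Partition n, (1 + ν.parts.count t) : ℕ) : ℝ) := fun n => by push_cast; rfl
  induction hr : N - s using Nat.strong_induction_on generalizing s with
  | _ n ih =>
    have hpn : (Fintype.card (Nat.Partition n) : ℝ) ≤ K * q ^ s := hr ▸ h s hs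
    have hKq : 0 ≤ K * q ^ s := by positivity
    rcases lt_or_ge n t with hn | hn
    · rw [hcast, sum_one_add_count_parts_of_lt hn, le_div_iff₀ hpos]
      refine (mul_le_mul_of_nonneg_right hpn hpos.le).trans ?_
      exact mul_le_of_le_one_right hKq (by linarith [pow_pos hq0 t])
    · have h1 := ih (n - t) (by omega) (s := s + t) (by omega) (by omega)
      rw [hcast, sum_one_add_count_parts ht hn, Nat.cast_add, ← hcast]
      calc _ ≤ K * q ^ s + K * q ^ (s + t) / (1 - q ^ t) := add_le_add hpn h1
        _ = K * q ^ s / (1 - q ^ t) := by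
          field_simp
          ring

end CountingEntries

section Boltzmann

open MeasureTheory ProbabilityTheory

/-- The Boltzmann law of parameter `q` on families of multiplicities: the number of parts of size
`i + 1` is geometric of parameter `q ^ (i + 1)`, independently for `i < N`. -/
noncomputable def boltzmannMeasure (q : unitInterval) (N : ℕ) : Measure (Fin N → ℕ) :=
  Measure.pi fun i => geometricMeasure (unitInterval.symm (q ^ (i.val + 1)))

instance (q : unitInterval) (N : ℕ) : IsProbabilityMeasure (boltzmannMeasure q N) := by
  unfold boltzmannMeasure
  infer_instance

/-- The size of the partition with the given multiplicities. -/
def weightedSize {N : ℕ} (v : Fin N → ℕ) : ℕ := ∑ i, (i.val + 1) * v i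

/-- The multiplicities of the parts `1, …, N` in a partition. -/
def multiplicities (N : ℕ) {n : ℕ} (ν : Nat.Partition n) : Fin N → ℕ :=
  fun i => ν.parts.count (i.val + 1)

/-- The normalizing factor of the Boltzmann law. -/
noncomputable def boltzmannWeight (q : unitInterval) (N : ℕ) : ℝ :=
  ∏ i : Fin N, (1 - (q : ℝ) ^ (i.val + 1))

theorem weightedSize_multiplicities {N n : ℕ} (hn : n ≤ N) (ν : Nat.Partition n) :
    weightedSize (multiplicities N ν) = n := by
  have hsub : ν.parts.toFinset ⊆ Finset.Icc 1 N := by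
    intro a ha
    rw [Multiset.mem_toFinset] at ha
    have h1 := Multiset.le_sum_of_mem ha
    rw [ν.parts_sum] at h1
    exact Finset.mem_Icc.2 ⟨ν.parts_pos ha, h1.trans hn⟩
  have h := Finset.sum_multiset_count_of_subset ν.parts _ hsub
  rw [ν.parts_sum] at h
  have h2 : Finset.Icc 1 N = Finset.Ico (0 + 1) (N + 1) := by
    ext
    simp
  rw [h2, ← Finset.sum_Ico_add' _ 0 N 1, ← Finset.range_eq_Ico] at h
  simp only [weightedSize, multiplicities]
  rw [Fin.sum_univ_eq_sum_range (fun i => (i + 1) * ν.parts.count (i + 1))]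
  conv_rhs => rw [h]
  exact Finset.sum_congr rfl fun i _ => by rw [smul_eq_mul, mul_comm]

theorem multiplicities_injective {N n : ℕ} (hn : n ≤ N) :
    Function.Injective (multiplicities N : Nat.Partition n → Fin N → ℕ) := by
  intro ν ρ h
  ext a
  rcases Nat.eq_zero_or_pos a with rfl | ha
  · rw [Multiset.count_eq_zero_of_notMem, Multiset.count_eq_zero_of_notMem]
    · exact fun h0 => absurd (ρ.parts_pos h0) (lt_irrefl 0)
    · exact fun h0 => absurd (ν.parts_pos h0) (lt_irrefl 0)
  rcases le_or_gt a N with haN | haN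
  · have := congrFun h ⟨a - 1, by omega⟩
    simpa [multiplicities, Nat.sub_add_cancel ha] using this
  · have key : ∀ τ : Nat.Partition n, a ∉ τ.parts := by
      intro τ h0
      have := Multiset.le_sum_of_mem h0
      rw [τ.parts_sum] at this
      omega
    rw [Multiset.count_eq_zero_of_notMem (key ν), Multiset.count_eq_zero_of_notMem (key ρ)]

theorem exists_multiplicities_eq {N : ℕ} (v : Fin N → ℕ) :
    ∃ ν : Nat.Partition (weightedSize v), multiplicities N ν = v := by
  refine ⟨⟨∑ i, Multiset.replicate (v i) (i.val + 1), ?_, ?_⟩, ?_⟩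
  · intro a ha
    obtain ⟨i, -, hi⟩ := Multiset.mem_sum.1 ha
    rw [Multiset.eq_of_mem_replicate hi]
    omega
  · rw [Multiset.sum_sum]
    simp [weightedSize, mul_comm]
  · funext i
    simp only [multiplicities]
    rw [Multiset.count_sum']
    simp only [Multiset.count_replicate]
    rw [Finset.sum_eq_single i]
    · simp
    · intro j _ hj
      rw [if_neg]
      intro h
      exact hj (Fin.ext (by omega))
    · simp

section

variable {q : unitInterval}

theorem symm_pow_ne_zero (hq : q < 1) (i : ℕ) : unitInterval.symm (q ^ (i + 1)) ≠ 0 := by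
  intro h
  have h1 : ((unitInterval.symm (q ^ (i + 1)) : unitInterval) : ℝ) = 0 := by rw [h]; rfl
  have h2 : (q : ℝ) < 1 := hq
  have h3 : (q : ℝ) ^ (i + 1) < 1 := pow_lt_one₀ q.2.1 h2 (by omega)
  rw [unitInterval.coe_symm_eq] at h1
  push_cast at h1
  linarith

theorem boltzmannWeight_pos (hq : q < 1) (N : ℕ) : 0 < boltzmannWeight q N :=
  Finset.prod_pos fun i _ => sub_pos.2 (pow_lt_one₀ q.2.1 hq (by omega))

theorem boltzmannMeasure_real_singleton (hq : q < 1) {N : ℕ} (v : Fin N → ℕ) :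
    (boltzmannMeasure q N).real {v} = boltzmannWeight q N * (q : ℝ) ^ weightedSize v := by
  have h : ({v} : Set (Fin N → ℕ)) = Set.univ.pi fun i => {v i} := by
    ext w
    simp [funext_iff]
  rw [boltzmannMeasure, h, measureReal_def, Measure.pi_pi, ENNReal.toReal_prod, boltzmannWeight,
    weightedSize, ← Finset.prod_pow_eq_pow_sum, ← Finset.prod_mul_distrib]
  refine Finset.prod_congr rfl fun i _ => ?_
  rw [← measureReal_def, geometricMeasure_real_singleton (symm_pow_ne_zero hq i),
    unitInterval.coe_symm_eq]
  push_cast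
  rw [sub_sub_cancel, ← pow_mul, mul_comm]

/-- Partitions of `n ≤ N` whose multiplicities lie in an event. -/
theorem card_mul_le_boltzmannMeasure_real (hq : q < 1) {N n : ℕ} (hn : n ≤ N)
    (E : Finset (Nat.Partition n)) {A : Set (Fin N → ℕ)} (hA : ∀ ν ∈ E, multiplicities N ν ∈ A) :
    E.card * (boltzmannWeight q N * (q : ℝ) ^ n) ≤ (boltzmannMeasure q N).real A := by
  classical
  have h1 : (boltzmannMeasure q N).real (E.image (multiplicities N) : Finset (Fin N → ℕ))
      = E.card * (boltzmannWeight q N * (q : ℝ) ^ n) := by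
    rw [← sum_measureReal_singleton,
      Finset.sum_image (multiplicities_injective hn).injOn, ← nsmul_eq_mul, ← Finset.sum_const]
    refine Finset.sum_congr rfl fun ν _ => ?_
    rw [boltzmannMeasure_real_singleton hq, weightedSize_multiplicities hn]
  rw [← h1]
  refine measureReal_mono ?_
  intro v hv
  obtain ⟨ν, hν, rfl⟩ := Finset.mem_image.1 (Finset.mem_coe.1 hv)
  exact hA ν hν

theorem boltzmannMeasure_real_weightedSize_eq (hq : q < 1) {N n : ℕ} (hn : n ≤ N) :
    (boltzmannMeasure q N).real {v | weightedSize v = n}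
      = Fintype.card (Nat.Partition n) * (boltzmannWeight q N * (q : ℝ) ^ n) := by
  classical
  have h : {v : Fin N → ℕ | weightedSize v = n}
      = ((Finset.univ.image (multiplicities N : Nat.Partition n → _) : Finset (Fin N → ℕ)) :
        Set (Fin N → ℕ)) := by
    ext v
    simp only [Finset.coe_image, Finset.coe_univ, Set.image_univ, Set.mem_range]
    constructor
    · rintro rfl
      exact exists_multiplicities_eq v
    · rintro ⟨ν, rfl⟩
      exact weightedSize_multiplicities hn ν
  rw [h, ← sum_measureReal_singleton,
    Finset.sum_image (multiplicities_injective hn).injOn]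
  simp only [boltzmannMeasure_real_singleton hq, weightedSize_multiplicities hn]
  rw [Finset.sum_const, nsmul_eq_mul, Finset.card_univ]

theorem geometricMeasure_real_le (hq : q < 1) (i k : ℕ) :
    (geometricMeasure (unitInterval.symm (q ^ (i + 1)))).real {n | k ≤ n}
      = (q : ℝ) ^ ((i + 1) * k) := by
  have h : {n : ℕ | k ≤ n} = ((Finset.range k : Finset ℕ) : Set ℕ)ᶜ := by
    ext n
    simp
  rw [h, measureReal_compl (Finset.measurableSet _), probReal_univ, ← sum_measureReal_singleton]
  simp only [geometricMeasure_real_singleton (symm_pow_ne_zero hq i), unitInterval.coe_symm_eq]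
  push_cast
  simp only [sub_sub_cancel]
  rw [← Finset.sum_mul, geom_sum_mul_neg, pow_mul]
  ring

theorem boltzmannMeasure_real_apply {N : ℕ} (i : Fin N) (s : Set ℕ) :
    (boltzmannMeasure q N).real {v | v i ∈ s}
      = (geometricMeasure (unitInterval.symm (q ^ (i.val + 1)))).real s := by
  have h := (measurePreserving_eval
    (fun i : Fin N => geometricMeasure (unitInterval.symm (q ^ (i.val + 1)))) i)
  exact h.measureReal_preimage (MeasurableSet.of_discrete).nullMeasurableSet

theorem boltzmannMeasure_real_le_apply (hq : q < 1) {N : ℕ} (i : Fin N) (k : ℕ) :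
    (boltzmannMeasure q N).real {v | k ≤ v i} = (q : ℝ) ^ ((i.val + 1) * k) := by
  rw [← geometricMeasure_real_le hq]
  exact boltzmannMeasure_real_apply i {n | k ≤ n}

end

end Boltzmann

section BoltzmannParameter

open MeasureTheory ProbabilityTheory

theorem card_partition_mono : Monotone fun n => Fintype.card (Nat.Partition n) := by
  refine monotone_nat_of_le_succ fun n => ?_
  have h := Fintype.card_congr (Nat.Partition.partitionWithPartEquiv (n := n + 1) le_rfl
    (Nat.succ_le_succ n.zero_le))
  exact (h.symm.trans_le (Fintype.card_subtype_le _))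

/-- Resampling one coordinate at a time moves a Boltzmann variable across `N` in small steps. -/
theorem boltzmannMeasure_crossing (q : unitInterval) (N L : ℕ) :
    (boltzmannMeasure q N).real {v | N ≤ weightedSize v} *
        (boltzmannMeasure q N).real {v | weightedSize v < N} ≤
      N * (boltzmannMeasure q N).real {v | N ≤ weightedSize v + L ∧ weightedSize v < N} +
        (boltzmannMeasure q N).real {v | ∃ i, L < (i.val + 1) * v i} := by
  set g : Fin N → Measure ℕ := fun i => geometricMeasure (unitInterval.symm (q ^ (i.val + 1)))
    with hg
  have hμ : boltzmannMeasure q N = Measure.pi g := rfl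
  set Q : Measure (Fin N → ℕ × ℕ) := Measure.pi fun i => (g i).prod (g i) with hQ
  set hyb : ℕ → (Fin N → ℕ × ℕ) → (Fin N → ℕ) :=
    fun j w i => if i.val < j then (w i).1 else (w i).2 with hhyb
  have hpres : ∀ j, MeasurePreserving (hyb j) Q (boltzmannMeasure q N) := by
    intro j
    rw [hμ, hhyb]
    have := measurePreserving_pi (fun i => (g i).prod (g i)) g
      (f := fun i (a : ℕ × ℕ) => if i.val < j then a.1 else a.2) (fun i => by
        by_cases h : i.val < j
        · simp only [h, if_true]
          exact measurePreserving_fst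
        · simp only [h, if_false]
          exact measurePreserving_snd)
    exact this
  have hreal : ∀ j s, Q.real (hyb j ⁻¹' s) = (boltzmannMeasure q N).real s := fun j s =>
    (hpres j).measureReal_preimage (MeasurableSet.of_discrete).nullMeasurableSet
  have hprod : (boltzmannMeasure q N).real {v | N ≤ weightedSize v} *
      (boltzmannMeasure q N).real {v | weightedSize v < N}
      = Q.real {w | N ≤ weightedSize (hyb 0 w) ∧ weightedSize (hyb N w) < N} := by
    have h := (measurePreserving_arrowProdEquivProdArrow ℕ ℕ (Fin N) g g).measureReal_preimage
      (s := {v : Fin N → ℕ | weightedSize v < N} ×ˢ {v : Fin N → ℕ | N ≤ weightedSize v})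
      (MeasurableSet.of_discrete).nullMeasurableSet
    rw [measureReal_prod_prod, ← hμ, mul_comm] at h
    rw [← h]
    congr 1
    ext w
    have h0 : hyb 0 w = fun i => (w i).2 := by
      funext i
      simp [hhyb]
    have h1 : hyb N w = fun i => (w i).1 := by
      funext i
      simp [hhyb]
    rw [Set.mem_ofPred_eq, h0, h1]
    simp [MeasurableEquiv.arrowProdEquivProdArrow, Equiv.arrowProdEquivProdArrow, and_comm]
  have hsub : {w | N ≤ weightedSize (hyb 0 w) ∧ weightedSize (hyb N w) < N} ⊆
      (⋃ j ∈ Finset.range N, hyb (j + 1) ⁻¹' {v | N ≤ weightedSize v + L ∧ weightedSize v < N}) ∪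
        hyb 0 ⁻¹' {v | ∃ i, L < (i.val + 1) * v i} := by
    rintro w ⟨h0, hN⟩
    by_cases hbad : ∃ i : Fin N, L < (i.val + 1) * (w i).2
    · refine Or.inr ?_
      simpa [hhyb] using hbad
    push Not at hbad
    refine Or.inl ?_
    have hex : ∃ j, weightedSize (hyb j w) < N := ⟨N, hN⟩
    classical
    set j := Nat.find hex with hj
    have hjs : weightedSize (hyb j w) < N := Nat.find_spec hex
    have hjN : j ≤ N := Nat.find_min' hex hN
    have hj0 : j ≠ 0 := by
      intro h
      rw [h] at hjs
      omega
    obtain ⟨k, hk⟩ := Nat.exists_eq_succ_of_ne_zero hj0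
    have hkN : k < N := by omega
    have hks : N ≤ weightedSize (hyb k w) :=
      not_lt.1 (Nat.find_min hex (show k < Nat.find hex by omega))
    have hstep : weightedSize (hyb k w) ≤ weightedSize (hyb (k + 1) w) + L := by
      rw [weightedSize, weightedSize, ← Finset.add_sum_erase _ _ (Finset.mem_univ ⟨k, hkN⟩),
        ← Finset.add_sum_erase _ _ (Finset.mem_univ ⟨k, hkN⟩)]
      have e1 : ∀ i ∈ Finset.univ.erase (⟨k, hkN⟩ : Fin N), (i.val + 1) * hyb k w i
          = (i.val + 1) * hyb (k + 1) w i := by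
        intro i hi
        have hne : i.val ≠ k := fun h => (Finset.mem_erase.1 hi).1 (Fin.ext h)
        have : (i.val < k) ↔ (i.val < k + 1) := by omega
        simp only [hhyb, this]
      rw [Finset.sum_congr rfl e1]
      have e2 : hyb k w ⟨k, hkN⟩ = (w ⟨k, hkN⟩).2 := by simp [hhyb]
      have := hbad ⟨k, hkN⟩
      rw [e2]
      simp only at this ⊢
      omega
    simp only [Set.mem_iUnion]
    rw [hk] at hjs
    exact ⟨k, Finset.mem_range.2 hkN, hks.trans hstep, hjs⟩
  rw [hprod]
  refine (measureReal_mono hsub).trans ((measureReal_union_le _ _).trans ?_)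
  rw [hreal]
  gcongr
  refine (measureReal_biUnion_finset_le _ _).trans ?_
  simp only [hreal]
  rw [Finset.sum_const, Finset.card_range, nsmul_eq_mul]

theorem boltzmannMeasure_real_exists_lt_le {q : unitInterval} (hq : q < 1) (N L : ℕ) :
    (boltzmannMeasure q N).real {v | ∃ i, L < (i.val + 1) * v i} ≤ N * (q : ℝ) ^ L := by
  have h : {v : Fin N → ℕ | ∃ i, L < (i.val + 1) * v i}
      = ⋃ i : Fin N, {v | L / (i.val + 1) + 1 ≤ v i} := by
    ext v
    simp only [Set.mem_ofPred_eq, Set.mem_iUnion]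
    refine exists_congr fun i => ?_
    rw [Nat.succ_le_iff, Nat.div_lt_iff_lt_mul (Nat.succ_pos _), mul_comm]
  rw [h]
  refine (measureReal_iUnion_fintype_le _).trans ?_
  have : ∀ i : Fin N, (boltzmannMeasure q N).real {v | L / (i.val + 1) + 1 ≤ v i} ≤ (q : ℝ) ^ L := by
    intro i
    rw [boltzmannMeasure_real_le_apply hq]
    refine pow_le_pow_of_le_one q.2.1 q.2.2 ?_
    have := Nat.lt_mul_div_succ L (Nat.succ_pos i.val)
    exact this.le
  refine (Finset.sum_le_sum fun i _ => this i).trans ?_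
  simp

/-- Markov's inequality for the number of events that occur. -/
theorem mul_measureReal_card_ge_le {Ω ι : Type*} [MeasurableSpace Ω] [DiscreteMeasurableSpace Ω]
    (μ : Measure Ω) [IsFiniteMeasure μ] (I : Finset ι) (A : ι → Set Ω)
    [∀ i, DecidablePred (· ∈ A i)] (a : ℕ) :
    a * μ.real {ω | a ≤ (I.filter fun i => ω ∈ A i).card} ≤ ∑ i ∈ I, μ.real (A i) := by
  have hInt : ∀ i ∈ I, Integrable ((A i).indicator fun _ => (1 : ℝ)) μ := fun i _ =>
    (integrable_const _).indicator MeasurableSet.of_discrete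
  have h := mul_meas_ge_le_integral_of_nonneg (μ := μ)
    (f := fun ω => ∑ i ∈ I, (A i).indicator (fun _ => (1 : ℝ)) ω)
    (Filter.Eventually.of_forall fun ω => Finset.sum_nonneg fun i _ =>
      Set.indicator_nonneg (fun _ _ => zero_le_one) ω) (integrable_finsetSum _ hInt) a
  rw [integral_finsetSum _ hInt] at h
  simp only [integral_indicator_const _ (MeasurableSet.of_discrete), smul_eq_mul, mul_one] at h
  refine le_trans (le_of_eq ?_) h
  congr 2
  ext ω
  simp only [Set.mem_ofPred_eq, Set.indicator_apply, Finset.sum_boole, Nat.cast_le]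

theorem boltzmannMeasure_real_weightedSize_lt {q : unitInterval} (hq : q < 1) (N : ℕ) :
    (boltzmannMeasure q N).real {v | weightedSize v < N}
      = ∑ n ∈ Finset.range N,
        (Fintype.card (Nat.Partition n) : ℝ) * (boltzmannWeight q N * (q : ℝ) ^ n) := by
  have h : {v : Fin N → ℕ | weightedSize v < N}
      = ⋃ n ∈ Finset.range N, {v | weightedSize v = n} := by
    ext v
    simp
  rw [h, measureReal_biUnion_finset]
  · exact Finset.sum_congr rfl fun n hn =>
      boltzmannMeasure_real_weightedSize_eq hq (Finset.mem_range.1 hn).le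
  · intro a _ b _ hab
    refine Set.disjoint_left.2 fun v hva hvb => hab ?_
    exact hva.symm.trans hvb
  · exact fun _ _ => MeasurableSet.of_discrete

/-- There is a Boltzmann parameter for which `N` is a median size. -/
theorem exists_boltzmannMeasure_real_eq_half {N : ℕ} (hN : 1 ≤ N) :
    ∃ q : unitInterval, 0 < q ∧ q < 1 ∧
      (boltzmannMeasure q N).real {v | weightedSize v < N} = 1 / 2 := by
  set F : ℝ → ℝ := fun t => (∏ i : Fin N, (1 - t ^ (i.val + 1))) *
    ∑ n ∈ Finset.range N, (Fintype.card (Nat.Partition n) : ℝ) * t ^ n with hF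
  have hc : ContinuousOn F (Set.Icc 0 1) := by
    apply Continuous.continuousOn
    rw [hF]
    fun_prop
  have hF0 : F 0 = 1 := by
    simp only [hF]
    rw [Finset.sum_eq_single 0]
    · simp
    · intro n _ hn
      simp [hn]
    · intro h
      exact absurd (Finset.mem_range.2 hN) h
  have hF1 : F 1 = 0 := by
    simp only [hF]
    rw [Finset.prod_eq_zero (Finset.mem_univ ⟨0, hN⟩) (by simp), zero_mul]
  obtain ⟨t, ht, hFt⟩ := intermediate_value_Icc' (zero_le_one) hc
    (show (1 / 2 : ℝ) ∈ Set.Icc (F 1) (F 0) by rw [hF0, hF1]; norm_num)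
  have h0 : t ≠ 0 := by
    rintro rfl
    rw [hF0] at hFt
    norm_num at hFt
  have h1 : t ≠ 1 := by
    rintro rfl
    rw [hF1] at hFt
    norm_num at hFt
  have ht0 : 0 < t := lt_of_le_of_ne ht.1 h0.symm
  have ht1 : t < 1 := lt_of_le_of_ne ht.2 h1
  refine ⟨⟨t, ht⟩, ht0, ht1, ?_⟩
  rw [boltzmannMeasure_real_weightedSize_lt (q := ⟨t, ht⟩) ht1, ← hFt]
  simp only [hF, boltzmannWeight]
  rw [Finset.mul_sum]
  refine Finset.sum_congr rfl fun n _ => ?_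
  ring

end BoltzmannParameter

section BoltzmannParameterBounds

open MeasureTheory ProbabilityTheory

theorem sum_weightedSize_le_sq {N L : ℕ} {v : Fin N → ℕ} (h : ∀ i, (i.val + 1) * v i ≤ L) :
    weightedSize v ≤ L ^ 2 := by
  have h1 : weightedSize v ≤ ∑ i : Fin N, if i.val < L then L else 0 := by
    refine Finset.sum_le_sum fun i _ => ?_
    split_ifs with hi
    · exact h i
    · have := h i
      rcases Nat.eq_zero_or_pos (v i) with h0 | h0
      · simp [h0]
      · have := Nat.le_mul_of_pos_right (i.val + 1) h0
        omega
  refine h1.trans ?_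
  rw [Fin.sum_univ_eq_sum_range (fun i => if i < L then L else 0), ← Finset.sum_filter,
    Finset.sum_const, smul_eq_mul, sq]
  refine Nat.mul_le_mul_right _ ?_
  calc ((Finset.range N).filter (· < L)).card ≤ (Finset.range L).card :=
        Finset.card_le_card fun i hi => Finset.mem_range.2 (Finset.mem_filter.1 hi).2
    _ = L := Finset.card_range L

theorem boltzmannMeasure_real_compl_half {q : unitInterval} {N : ℕ}
    (hhalf : (boltzmannMeasure q N).real {v | weightedSize v < N} = 1 / 2) :
    (boltzmannMeasure q N).real {v | N ≤ weightedSize v} = 1 / 2 := by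
  have h : {v : Fin N → ℕ | N ≤ weightedSize v} = {v | weightedSize v < N}ᶜ := by
    ext v
    simp
  rw [h, probReal_compl_eq_one_sub MeasurableSet.of_discrete, hhalf]
  norm_num

theorem le_sq_of_boltzmann_median {q : unitInterval} (hq : q < 1) {N L : ℕ}
    (hhalf : (boltzmannMeasure q N).real {v | weightedSize v < N} = 1 / 2)
    (hL : N * (q : ℝ) ^ L < 1 / 2) : N ≤ L ^ 2 := by
  by_contra! hlt
  have h1 := boltzmannMeasure_real_compl_half hhalf
  have h2 := boltzmannMeasure_real_exists_lt_le hq N L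
  have h3 : {v : Fin N → ℕ | N ≤ weightedSize v} ⊆ {v | ∃ i, L < (i.val + 1) * v i} := by
    intro v hv
    by_contra hcon
    simp only [Set.mem_ofPred_eq, not_exists, not_lt] at hcon hv
    exact absurd (sum_weightedSize_le_sq hcon) (by omega)
  have h4 := measureReal_mono (μ := boltzmannMeasure q N) h3
  linarith

theorem one_le_mul_of_boltzmann_median {q : unitInterval} (hq : q < 1) {N a : ℕ} {x : ℝ}
    (hqx : (q : ℝ) = Real.exp (-x))
    (hhalf : (boltzmannMeasure q N).real {v | weightedSize v < N} = 1 / 2)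
    (ha : 0 < a) (haN : N ≤ a ^ 2) (ha3 : 3 * a ≤ N) : 1 ≤ 12 * a * x := by
  classical
  set I : Finset (Fin N) := Finset.univ.filter fun i => a ≤ i.val ∧ i.val < 3 * a with hI
  have hIcard : I.card = 2 * a := by
    have : I.card = (Finset.Ico a (3 * a)).card := by
      refine Finset.card_bij (fun i _ => i.val) ?_ ?_ ?_
      · intro i hi
        rw [hI, Finset.mem_filter] at hi
        exact Finset.mem_Ico.2 hi.2
      · intro i _ j _ h
        exact Fin.ext h
      · intro b hb
        rw [Finset.mem_Ico] at hb
        exact ⟨⟨b, by omega⟩, by simp [hI, hb], rfl⟩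
    rw [this, Nat.card_Ico]
    omega
  have hM := mul_measureReal_card_ge_le (boltzmannMeasure q N) I (fun i => {v | v i = 0}) a
  have hsub : {v : Fin N → ℕ | weightedSize v < N} ⊆
      {v | a ≤ (I.filter fun i => v ∈ {v : Fin N → ℕ | v i = 0}).card} := by
    intro v hv
    rw [Set.mem_ofPred_eq] at hv ⊢
    have h1 := Finset.card_filter_add_card_filter_not (s := I) (fun i => v i = 0)
    have h2 : a * (I.filter fun i => ¬ v i = 0).card ≤ weightedSize v := by
      rw [weightedSize, mul_comm, ← smul_eq_mul, ← Finset.sum_const]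
      refine (Finset.sum_le_sum fun i hi => ?_).trans
        (Finset.sum_le_sum_of_subset (Finset.subset_univ _))
      rw [Finset.mem_filter, hI, Finset.mem_filter] at hi
      have := Nat.le_mul_of_pos_right (i.val + 1) (Nat.pos_of_ne_zero hi.2)
      omega
    have h3 : (I.filter fun i => ¬ v i = 0).card < a := by
      by_contra h
      rw [not_lt] at h
      have := Nat.mul_le_mul_left a h
      rw [← sq] at this
      omega
    simp only [Set.mem_ofPred_eq]
    omega
  have h1 := measureReal_mono (μ := boltzmannMeasure q N) hsub
  rw [hhalf] at h1
  have h2 : ∀ i ∈ I, (boltzmannMeasure q N).real {v | v i = 0} ≤ 3 * a * x := by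
    intro i hi
    have e : {v : Fin N → ℕ | v i = 0} = {v | 1 ≤ v i}ᶜ := by
      ext v
      simp
    rw [e, probReal_compl_eq_one_sub MeasurableSet.of_discrete,
      boltzmannMeasure_real_le_apply hq, hqx, ← Real.exp_nat_mul]
    have h4 := Real.add_one_le_exp (((((i.val + 1) * 1 : ℕ)) : ℝ) * -x)
    have h5 : (((i.val + 1) * 1 : ℕ) : ℝ) ≤ 3 * a := by
      rw [hI, Finset.mem_filter] at hi
      have : (i.val + 1) * 1 ≤ 3 * a := by omega
      exact_mod_cast this
    have hx : 0 ≤ x := by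
      by_contra! hneg
      have h6 : (q : ℝ) < 1 := hq
      rw [hqx, Real.exp_lt_one_iff] at h6
      linarith
    nlinarith
  have h3 := Finset.sum_le_card_nsmul I _ _ h2
  rw [hIcard, nsmul_eq_mul] at h3
  push_cast at h3
  have ha' : (0 : ℝ) < a := by exact_mod_cast ha
  have h4 : (a : ℝ) * (1 / 2) ≤ a * (6 * a * x) := by
    calc (a : ℝ) * (1 / 2) ≤ _ := mul_le_mul_of_nonneg_left h1 ha'.le
      _ ≤ _ := hM
      _ ≤ _ := h3
      _ = _ := by ring
  have := le_of_mul_le_mul_left h4 ha'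
  linarith

theorem boltzmann_median_lower_bound {q : unitInterval} (hq : q < 1) {N L : ℕ}
    (hhalf : (boltzmannMeasure q N).real {v | weightedSize v < N} = 1 / 2)
    (hL : N * (q : ℝ) ^ L ≤ 1 / 8) :
    (q : ℝ) ^ L ≤ 8 * N * L *
      ((Fintype.card (Nat.Partition N) : ℝ) * (boltzmannWeight q N * (q : ℝ) ^ N)) := by
  have hq0 : (0 : ℝ) ≤ q := q.2.1
  have hq1 : (q : ℝ) ≤ 1 := q.2.2
  have hW := (boltzmannWeight_pos hq N).le
  have h1 := boltzmannMeasure_crossing q N L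
  rw [hhalf, boltzmannMeasure_real_compl_half hhalf] at h1
  have h2 := boltzmannMeasure_real_exists_lt_le hq N L
  set P := (boltzmannMeasure q N).real {v | N ≤ weightedSize v + L ∧ weightedSize v < N} with hP
  set G := (Fintype.card (Nat.Partition N) : ℝ) * (boltzmannWeight q N * (q : ℝ) ^ N) with hG
  have h3 : 1 / 8 ≤ N * P := by linarith
  have h4 : {v : Fin N → ℕ | N ≤ weightedSize v + L ∧ weightedSize v < N}
      ⊆ ⋃ n ∈ Finset.Ico (N - L) N, {v | weightedSize v = n} := by
    intro v hv
    rw [Set.mem_ofPred_eq] at hv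
    simp only [Set.mem_iUnion]
    exact ⟨weightedSize v, Finset.mem_Ico.2 (by omega), rfl⟩
  have h5 : P ≤ ∑ n ∈ Finset.Ico (N - L) N, (boltzmannMeasure q N).real {v | weightedSize v = n} :=
    (measureReal_mono h4 (measure_ne_top _ _)).trans (measureReal_biUnion_finset_le _ _)
  have h6 : ∀ n ∈ Finset.Ico (N - L) N,
      (q : ℝ) ^ L * (boltzmannMeasure q N).real {v | weightedSize v = n} ≤ G := by
    intro n hn
    rw [Finset.mem_Ico] at hn
    rw [boltzmannMeasure_real_weightedSize_eq hq hn.2.le, hG]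
    have hpow : (q : ℝ) ^ (L + n) ≤ (q : ℝ) ^ N := pow_le_pow_of_le_one hq0 hq1 (by omega)
    have hcard : (Fintype.card (Nat.Partition n) : ℝ) ≤ Fintype.card (Nat.Partition N) := by
      exact_mod_cast card_partition_mono hn.2.le
    calc (q : ℝ) ^ L * (Fintype.card (Nat.Partition n) * (boltzmannWeight q N * (q : ℝ) ^ n))
        = Fintype.card (Nat.Partition n) * (boltzmannWeight q N * (q : ℝ) ^ (L + n)) := by
          rw [pow_add]
          ring
      _ ≤ _ := by gcongr
  have h7 : (q : ℝ) ^ L * P ≤ L * G := by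
    calc (q : ℝ) ^ L * P ≤ (q : ℝ) ^ L * ∑ n ∈ Finset.Ico (N - L) N,
          (boltzmannMeasure q N).real {v | weightedSize v = n} := by gcongr
      _ = ∑ n ∈ Finset.Ico (N - L) N,
          (q : ℝ) ^ L * (boltzmannMeasure q N).real {v | weightedSize v = n} := Finset.mul_sum _ _ _
      _ ≤ (Finset.Ico (N - L) N).card • G := Finset.sum_le_card_nsmul _ _ _ h6
      _ ≤ L * G := by
          rw [nsmul_eq_mul]
          gcongr
          rw [Nat.card_Ico]
          omega
  have h8 : 0 ≤ (q : ℝ) ^ L := by positivity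
  calc (q : ℝ) ^ L = 8 * ((q : ℝ) ^ L * (1 / 8)) := by ring
    _ ≤ 8 * ((q : ℝ) ^ L * (N * P)) := by gcongr
    _ = 8 * N * ((q : ℝ) ^ L * P) := by ring
    _ ≤ 8 * N * (L * G) := by gcongr
    _ = _ := by ring

/-- The Boltzmann parameter `q = exp (-x)` whose median size is `N`. -/
theorem exists_boltzmann_parameter :
    ∀ᶠ N : ℕ in Filter.atTop, ∃ (q : unitInterval) (x : ℝ), 0 < x ∧ (q : ℝ) = Real.exp (-x) ∧
      x * √N ≤ 4 * Real.log N ∧ 1 ≤ 24 * √N * x ∧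
      1 ≤ (N : ℝ) ^ 5 *
        ((Fintype.card (Nat.Partition N) : ℝ) * (boltzmannWeight q N * (q : ℝ) ^ N)) := by
  have hlog : ∀ᶠ N : ℕ in Filter.atTop, Real.log N ≤ 1 / 50 * (N : ℝ) ^ (1 / 2 : ℝ) := by
    have h := (isLittleO_log_rpow_atTop (r := 1 / 2) (by norm_num)).bound
      (show (0 : ℝ) < 1 / 50 by norm_num)
    filter_upwards [tendsto_natCast_atTop_atTop.eventually h, Filter.eventually_ge_atTop 1]
      with N hN h1
    have h2 : (1 : ℝ) ≤ N := by exact_mod_cast h1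
    rw [Real.norm_of_nonneg (Real.log_nonneg h2), Real.norm_of_nonneg (by positivity)] at hN
    exact hN
  filter_upwards [hlog, Filter.eventually_ge_atTop 100] with N hlogN hN100
  rw [← Real.sqrt_eq_rpow] at hlogN
  obtain ⟨q, hq0, hq, hhalf⟩ := exists_boltzmannMeasure_real_eq_half (N := N) (by omega)
  have hq0' : (0 : ℝ) < q := hq0
  have hq1' : (q : ℝ) < 1 := hq
  set x := -Real.log q with hx
  have hx0 : 0 < x := by
    have := Real.log_neg hq0' hq1'
    linarith
  have hqx : (q : ℝ) = Real.exp (-x) := by rw [hx, neg_neg, Real.exp_log hq0']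
  have hNR : (100 : ℝ) ≤ N := by exact_mod_cast hN100
  have hN0 : (0 : ℝ) < N := by linarith
  set r := √(N : ℝ) with hr
  have hrr : r * r = N := Real.mul_self_sqrt hN0.le
  have hr10 : 10 ≤ r := by
    rw [hr]
    exact Real.le_sqrt_of_sq_le (by norm_num; exact hN100)
  set ℓ := Real.log N with hℓ
  have hℓ0 : 1 ≤ ℓ := by
    rw [hℓ, Real.le_log_iff_exp_le hN0]
    have := Real.exp_one_lt_d9
    linarith
  set L := ⌈2 * ℓ / x⌉₊ with hLdef
  have hLlow : 2 * ℓ / x ≤ L := Nat.le_ceil _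
  have hLup : (L : ℝ) < 2 * ℓ / x + 1 := Nat.ceil_lt_add_one (by positivity)
  have hLx : 2 * ℓ ≤ L * x := (div_le_iff₀ hx0).1 hLlow
  have hLx' : L * x < 2 * ℓ + x := by
    have h := mul_lt_mul_of_pos_right hLup hx0
    rwa [add_mul, div_mul_cancel₀ _ hx0.ne', one_mul] at h
  have hexpℓ : Real.exp ℓ = N := Real.exp_log hN0
  have hpowL : (q : ℝ) ^ L = Real.exp (-(L * x)) := by
    rw [hqx, ← Real.exp_nat_mul]
    ring_nf
  have hNL : N * (q : ℝ) ^ L ≤ 1 / 100 := by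
    rw [hpowL]
    calc N * Real.exp (-(L * x)) ≤ N * Real.exp (-ℓ + -ℓ) := by
          gcongr
          linarith
      _ = (N : ℝ)⁻¹ := by
          rw [Real.exp_add, Real.exp_neg, hexpℓ]
          field_simp
      _ ≤ 1 / 100 := by
          rw [one_div]
          exact inv_anti₀ (by norm_num) hNR
  have hupper : x * r ≤ 4 * ℓ := by
    have h1 := le_sq_of_boltzmann_median hq hhalf (lt_of_le_of_lt hNL (by norm_num))
    have h2 : (N : ℝ) ≤ (L : ℝ) ^ 2 := by exact_mod_cast h1
    have h3 : r ≤ L := by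
      rw [hr]
      exact Real.sqrt_le_left (by positivity) |>.2 h2
    nlinarith
  have hlower : 1 ≤ 24 * r * x := by
    set a := ⌈r⌉₊ with ha
    have ha1 : r ≤ a := Nat.le_ceil _
    have ha2 : (a : ℝ) < r + 1 := Nat.ceil_lt_add_one (by positivity)
    have ha3 : N ≤ a ^ 2 := by
      have : (N : ℝ) ≤ (a : ℝ) ^ 2 := by nlinarith
      exact_mod_cast this
    have ha4 : 3 * a ≤ N := by
      have : (3 * a : ℝ) ≤ N := by nlinarith
      exact_mod_cast this
    have ha0 : 0 < a := Nat.ceil_pos.2 (by linarith)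
    have := one_le_mul_of_boltzmann_median hq hqx hhalf ha0 ha3 ha4
    nlinarith
  refine ⟨q, x, hx0, hqx, hupper, hlower, ?_⟩
  have h1 := boltzmann_median_lower_bound hq hhalf (hNL.trans (by norm_num))
  set G := (Fintype.card (Nat.Partition N) : ℝ) * (boltzmannWeight q N * (q : ℝ) ^ N) with hG
  have hG0 : 0 ≤ G := by
    have := (boltzmannWeight_pos hq N).le
    positivity
  have hx1 : x ≤ 1 := by
    have : 4 * ℓ ≤ r := by linarith
    have h2 : x * r ≤ 1 * r := by linarith
    exact le_of_mul_le_mul_right h2 (by linarith)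
  have hLN : (L : ℝ) ≤ N := by
    have h2 : 2 * ℓ / x ≤ 48 * r * ℓ := by
      rw [div_le_iff₀ hx0]
      nlinarith
    have h3 : 48 * r * ℓ ≤ 48 / 50 * (r * r) := by nlinarith
    nlinarith
  have h2 : ((N : ℝ) ^ 2 * 3)⁻¹ ≤ (q : ℝ) ^ L := by
    rw [hpowL]
    have h3 : Real.exp (-(ℓ + ℓ + 1)) ≤ Real.exp (-(L * x)) := by
      rw [Real.exp_le_exp]
      linarith
    refine le_trans ?_ h3
    rw [Real.exp_neg, Real.exp_add, Real.exp_add, hexpℓ, ← sq]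
    have := Real.exp_one_lt_d9
    refine inv_anti₀ (by positivity) ?_
    gcongr
    linarith
  have h3 : ((N : ℝ) ^ 2 * 3)⁻¹ ≤ 8 * N * N * G := by
    refine (h2.trans h1).trans ?_
    gcongr
  rw [inv_le_iff_one_le_mul₀ (by positivity)] at h3
  refine h3.trans ?_
  have h4 : 0 ≤ (N : ℝ) ^ 4 * G := by positivity
  calc 8 * N * N * G * ((N : ℝ) ^ 2 * 3) = 24 * ((N : ℝ) ^ 4 * G) := by ring
    _ ≤ N * ((N : ℝ) ^ 4 * G) := mul_le_mul_of_nonneg_right (by linarith) h4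
    _ = _ := by ring

end BoltzmannParameterBounds

section PartitionDecay

open MeasureTheory ProbabilityTheory

/-- `q = exp (-x)` is a Boltzmann parameter adapted to partitions of `N`. -/
structure IsBoltzmannParameter (N : ℕ) (q : unitInterval) (x : ℝ) : Prop where
  pos : 0 < x
  eq_exp : (q : ℝ) = Real.exp (-x)
  mul_sqrt_le : x * √N ≤ 4 * Real.log N
  one_le : 1 ≤ 24 * √N * x
  weight_ge : 1 ≤ (N : ℝ) ^ 5 *
    ((Fintype.card (Nat.Partition N) : ℝ) * (boltzmannWeight q N * (q : ℝ) ^ N))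

theorem IsBoltzmannParameter.lt_one {N : ℕ} {q : unitInterval} {x : ℝ}
    (h : IsBoltzmannParameter N q x) : q < 1 := by
  have h1 : (q : ℝ) < 1 := by
    rw [h.eq_exp, Real.exp_lt_one_iff]
    linarith [h.pos]
  exact h1

/-- An event of small Boltzmann probability contains few partitions. -/
theorem IsBoltzmannParameter.card_le {N n a : ℕ} {q : unitInterval} {x : ℝ}
    (h : IsBoltzmannParameter N q x) (hn : n + a = N) (E : Finset (Nat.Partition n))
    {A : Set (Fin N → ℕ)} (hA : ∀ ν ∈ E, multiplicities N ν ∈ A) :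
    (E.card : ℝ) ≤ (N : ℝ) ^ 5 * Fintype.card (Nat.Partition N) * (q : ℝ) ^ a *
      (boltzmannMeasure q N).real A := by
  have h1 := card_mul_le_boltzmannMeasure_real h.lt_one (N := N) (by omega) E hA
  have hq0 : (0 : ℝ) ≤ q := q.2.1
  calc (E.card : ℝ) = E.card * 1 := (mul_one _).symm
    _ ≤ E.card * ((N : ℝ) ^ 5 *
        ((Fintype.card (Nat.Partition N) : ℝ) * (boltzmannWeight q N * (q : ℝ) ^ N))) := by
        gcongr
        exact h.weight_ge
    _ = (N : ℝ) ^ 5 * Fintype.card (Nat.Partition N) * (q : ℝ) ^ a *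
        (E.card * (boltzmannWeight q N * (q : ℝ) ^ n)) := by
        rw [← hn, pow_add]
        ring
    _ ≤ _ := by gcongr

/-- Chernoff bound for the number of part sizes in `I` that occur. -/
theorem boltzmannMeasure_real_card_ge_le {q : unitInterval} (hq : q < 1) {N : ℕ}
    (I : Finset (Fin N)) {M : ℝ} (hM : ∑ i ∈ I, (q : ℝ) ^ (i.val + 1) ≤ M) :
    (boltzmannMeasure q N).real {v | 4 * M ≤ ((I.filter fun i => 1 ≤ v i).card : ℝ)}
      ≤ Real.exp (-2 * M) := by
  set f : Fin N → ℕ → ℝ := fun i n => if i ∈ I ∧ 1 ≤ n then Real.exp 1 else 1 with hf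
  set g : Fin N → Measure ℕ := fun i => geometricMeasure (unitInterval.symm (q ^ (i.val + 1)))
    with hg
  have hprod : ∀ v : Fin N → ℕ, ∏ i, f i (v i)
      = Real.exp ((I.filter fun i => 1 ≤ v i).card : ℝ) := by
    intro v
    simp only [hf]
    rw [Finset.prod_ite, Finset.prod_const, Finset.prod_const_one, mul_one,
      ← Real.exp_nat_mul, mul_one]
    congr 2
    congr 1
    ext i
    simp
  have hInt : ∀ i, ∫ n, f i n ∂(g i)
      = 1 + if i ∈ I then (Real.exp 1 - 1) * (q : ℝ) ^ (i.val + 1) else 0 := by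
    intro i
    by_cases hi : i ∈ I
    · have e : f i = fun n => 1 + ({n : ℕ | 1 ≤ n}.indicator fun _ => Real.exp 1 - 1) n := by
        funext n
        by_cases hn : 1 ≤ n
        · simp [hf, hi, hn, Set.indicator]
        · simp [hf, hi, hn, Set.indicator]
      rw [e, integral_add (integrable_const _)
        ((integrable_const _).indicator MeasurableSet.of_discrete),
        integral_indicator_const _ MeasurableSet.of_discrete, hg,
        geometricMeasure_real_le hq, mul_one, if_pos hi, smul_eq_mul, mul_comm]
      simp
    · simp [hf, hi]
  have hE : ∫ v, Real.exp ((I.filter fun i => 1 ≤ v i).card : ℝ) ∂(boltzmannMeasure q N)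
      = ∏ i, (1 + if i ∈ I then (Real.exp 1 - 1) * (q : ℝ) ^ (i.val + 1) else 0) := by
    simp only [← hprod, ← hInt]
    exact integral_fintype_prod_eq_prod f
  have he1 : 0 ≤ Real.exp 1 - 1 := by
    have := Real.add_one_le_exp 1
    linarith
  have he2 : Real.exp 1 - 1 ≤ 2 := by
    have := Real.exp_one_lt_d9
    linarith
  have hq0 : (0 : ℝ) ≤ q := q.2.1
  have hsum0 : 0 ≤ ∑ i ∈ I, (q : ℝ) ^ (i.val + 1) := Finset.sum_nonneg fun _ _ => by positivity
  have hEle : ∫ v, Real.exp ((I.filter fun i => 1 ≤ v i).card : ℝ) ∂(boltzmannMeasure q N)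
      ≤ Real.exp (2 * M) := by
    rw [hE]
    have h1 : ∀ i : Fin N, 1 + (if i ∈ I then (Real.exp 1 - 1) * (q : ℝ) ^ (i.val + 1) else 0)
        ≤ Real.exp (if i ∈ I then (Real.exp 1 - 1) * (q : ℝ) ^ (i.val + 1) else 0) := by
      intro i
      rw [add_comm]
      exact Real.add_one_le_exp _
    refine (Finset.prod_le_prod (fun i _ => ?_) fun i _ => h1 i).trans ?_
    · split_ifs <;> positivity
    · rw [← Real.exp_sum, Real.exp_le_exp, ← Finset.sum_filter, ← Finset.mul_sum,
        Finset.filter_mem_eq_inter, Finset.univ_inter]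
      exact mul_le_mul he2 hM hsum0 (by norm_num)
  have hEpos : 0 < ∫ v, Real.exp ((I.filter fun i => 1 ≤ v i).card : ℝ)
      ∂(boltzmannMeasure q N) := by
    rw [hE]
    refine Finset.prod_pos fun i _ => ?_
    split_ifs <;> positivity
  have hI : Integrable (fun v : Fin N → ℕ => Real.exp ((I.filter fun i => 1 ≤ v i).card : ℝ))
      (boltzmannMeasure q N) := by
    by_contra h
    rw [integral_undef h] at hEpos
    exact lt_irrefl _ hEpos
  have hmark := mul_meas_ge_le_integral_of_nonneg
    (Filter.Eventually.of_forall fun v => (Real.exp_pos _).le) hI (Real.exp (4 * M))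
  simp only [Real.exp_le_exp] at hmark
  have h2 := hmark.trans hEle
  rw [mul_comm, ← le_div_iff₀ (Real.exp_pos _), ← Real.exp_sub] at h2
  refine h2.trans (le_of_eq ?_)
  congr 1
  ring

/-- Counting pairs of a partition of `n` and a part size in a window. -/
theorem sum_card_partition_sub {n : ℕ} (W : Finset ℕ) (hW : ∀ t ∈ W, 1 ≤ t ∧ t ≤ n) :
    ∑ t ∈ W, Fintype.card (Nat.Partition (n - t))
      = ∑ ν : Nat.Partition n, (W.filter fun t => t ∈ ν.parts).card := by
  simp only [Finset.card_filter]
  rw [Finset.sum_comm]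
  refine Finset.sum_congr rfl fun t ht => ?_
  rw [← Fintype.card_congr (Nat.Partition.partitionWithPartEquiv (hW t ht).1 (hW t ht).2),
    Fintype.card_subtype, Finset.card_filter]

theorem IsBoltzmannParameter.decay_step {N a s h : ℕ} {q : unitInterval} {x K : ℝ}
    (hB : IsBoltzmannParameter N q x) (hs : 1 ≤ s) (hh : 1 ≤ h) (hN : a + s + h ≤ N)
    (hK : 1 ≤ K) (hxh : x * h ≤ 2)
    (hbig : (N : ℝ) ^ 5 * Real.exp (-2 * (h * (q : ℝ) ^ s)) ≤ (q : ℝ) ^ s)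
    (ha : (Fintype.card (Nat.Partition (N - a)) : ℝ)
      ≤ K * (Fintype.card (Nat.Partition N) * (q : ℝ) ^ a)) :
    (Fintype.card (Nat.Partition (N - (a + s + h))) : ℝ)
      ≤ 40 * K * (Fintype.card (Nat.Partition N) * (q : ℝ) ^ (a + s + h)) := by
  classical
  have hq0 : (0 : ℝ) < q := by
    rw [hB.eq_exp]
    exact Real.exp_pos _
  have hq1 : (q : ℝ) ≤ 1 := q.2.2
  set pN : ℝ := (Fintype.card (Nat.Partition N) : ℝ) with hpN
  have hpN0 : 0 ≤ pN := by positivity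
  set n := N - a with hn
  set M : ℝ := h * (q : ℝ) ^ s with hM
  set W := Finset.Ico s (s + h) with hW
  set I : Finset (Fin N) := Finset.univ.filter fun i => i.val + 1 ∈ W with hI
  have hcardW : ∀ P : ℕ → Prop, ∀ [DecidablePred P],
      (I.filter fun i => P (i.val + 1)).card = (W.filter P).card := by
    intro P _
    refine Finset.card_bij (fun i _ => i.val + 1) ?_ ?_ ?_
    · intro i hi
      rw [Finset.mem_filter, hI, Finset.mem_filter] at hi
      exact Finset.mem_filter.2 ⟨hi.1.2, hi.2⟩
    · intro i _ j _ hij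
      exact Fin.ext (by omega)
    · intro b hb
      rw [Finset.mem_filter, hW, Finset.mem_Ico] at hb
      refine ⟨⟨b - 1, by omega⟩, ?_, by simp only; omega⟩
      have hb1 : b - 1 + 1 = b := by omega
      simp only [Finset.mem_filter, hI, hW, hb1, Finset.mem_univ, true_and, Finset.mem_Ico]
      exact hb
  have hIcard : I.card = h := by
    have := hcardW (fun _ => True)
    simp only [Finset.filter_true] at this
    rw [this, hW, Nat.card_Ico]
    omega
  have hIsum : ∑ i ∈ I, (q : ℝ) ^ (i.val + 1) ≤ M := by
    refine (Finset.sum_le_card_nsmul I _ ((q : ℝ) ^ s) fun i hi => ?_).trans ?_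
    · rw [hI, Finset.mem_filter, hW, Finset.mem_Ico] at hi
      exact pow_le_pow_of_le_one hq0.le hq1 hi.2.1
    · rw [hIcard, nsmul_eq_mul]
  have hch := boltzmannMeasure_real_card_ge_le hB.lt_one I hIsum
  set E : Finset (Nat.Partition n) :=
    Finset.univ.filter fun ν => 4 * M ≤ ((W.filter fun t => t ∈ ν.parts).card : ℝ) with hE
  have hEcard : (E.card : ℝ) ≤ (N : ℝ) ^ 5 * pN * (q : ℝ) ^ a * Real.exp (-2 * M) := by
    refine (hB.card_le (a := a) (by omega) E (A := {v | 4 * M ≤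
      ((I.filter fun i => 1 ≤ v i).card : ℝ)}) fun ν hν => ?_).trans ?_
    · rw [hE, Finset.mem_filter] at hν
      have h1 := hν.2
      rw [← hcardW] at h1
      simp only [Set.mem_ofPred_eq, multiplicities, Multiset.one_le_count_iff_mem]
      convert! h1
    · gcongr
  have hsum := sum_card_partition_sub (n := n) W fun t ht => by
    rw [hW, Finset.mem_Ico] at ht
    omega
  have hlow : (h : ℝ) * Fintype.card (Nat.Partition (N - (a + s + h)))
      ≤ ((∑ t ∈ W, Fintype.card (Nat.Partition (n - t)) : ℕ) : ℝ) := by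
    have h1 : W.card • Fintype.card (Nat.Partition (N - (a + s + h)))
        ≤ ∑ t ∈ W, Fintype.card (Nat.Partition (n - t)) := by
      refine Finset.card_nsmul_le_sum _ _ _ fun t ht => card_partition_mono ?_
      rw [hW, Finset.mem_Ico] at ht
      omega
    have h2 : W.card = h := by
      rw [hW, Nat.card_Ico]
      omega
    rw [h2, smul_eq_mul] at h1
    exact_mod_cast h1
  have hup : ((∑ ν : Nat.Partition n, (W.filter fun t => t ∈ ν.parts).card : ℕ) : ℝ)
      ≤ Fintype.card (Nat.Partition n) * (4 * M) + E.card * h := by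
    push_cast
    have h1 : ∀ ν : Nat.Partition n, ((W.filter fun t => t ∈ ν.parts).card : ℝ)
        ≤ 4 * M + if ν ∈ E then (h : ℝ) else 0 := by
      intro ν
      by_cases hν : ν ∈ E
      · rw [if_pos hν]
        have h2 : (W.filter fun t => t ∈ ν.parts).card ≤ h := by
          refine (Finset.card_filter_le _ _).trans (le_of_eq ?_)
          rw [hW, Nat.card_Ico]
          omega
        have h3 : ((W.filter fun t => t ∈ ν.parts).card : ℝ) ≤ h := by exact_mod_cast h2
        have h4 : 0 ≤ M := by positivity
        linarith
      · rw [if_neg hν, add_zero]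
        rw [hE, Finset.mem_filter] at hν
        push Not at hν
        exact (hν (Finset.mem_univ _)).le
    refine (Finset.sum_le_sum fun ν _ => h1 ν).trans (le_of_eq ?_)
    rw [Finset.sum_add_distrib, Finset.sum_const, nsmul_eq_mul, Finset.card_univ,
      ← Finset.sum_filter, Finset.sum_const, nsmul_eq_mul, Finset.filter_mem_eq_inter,
      Finset.univ_inter]
  rw [hsum] at hlow
  have hh0 : (0 : ℝ) < h := by exact_mod_cast hh
  have hmain : (h : ℝ) * Fintype.card (Nat.Partition (N - (a + s + h)))
      ≤ h * ((4 * K + 1) * (pN * (q : ℝ) ^ a * (q : ℝ) ^ s)) := by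
    refine (hlow.trans hup).trans ?_
    have e1 : (Fintype.card (Nat.Partition n) : ℝ) * (4 * M)
        ≤ K * (pN * (q : ℝ) ^ a) * (4 * M) := by gcongr
    have e2 : (E.card : ℝ) * h ≤ pN * (q : ℝ) ^ a * (q : ℝ) ^ s * h := by
      calc (E.card : ℝ) * h ≤ (N : ℝ) ^ 5 * pN * (q : ℝ) ^ a * Real.exp (-2 * M) * h := by gcongr
        _ = pN * (q : ℝ) ^ a * ((N : ℝ) ^ 5 * Real.exp (-2 * M)) * h := by ring
        _ ≤ _ := by gcongr
    refine (add_le_add e1 e2).trans (le_of_eq ?_)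
    rw [hM]
    ring
  have hmain' := le_of_mul_le_mul_left hmain hh0
  have hqh : 1 ≤ 8 * (q : ℝ) ^ h := by
    rw [hB.eq_exp, ← Real.exp_nat_mul]
    have h1 : Real.exp (-2) ≤ Real.exp (h * -x) := by
      rw [Real.exp_le_exp]
      linarith
    have h2 : Real.exp 2 ≤ 8 := by
      have h3 := Real.exp_one_lt_d9
      have h4 : Real.exp 2 = Real.exp 1 * Real.exp 1 := by
        rw [← Real.exp_add]
        norm_num
      rw [h4]
      nlinarith [Real.exp_pos 1]
    have h5 : 1 / 8 ≤ Real.exp (-2) := by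
      rw [Real.exp_neg, one_div]
      exact inv_anti₀ (Real.exp_pos _) h2
    linarith
  refine hmain'.trans ?_
  have h0 : 0 ≤ pN * (q : ℝ) ^ a * (q : ℝ) ^ s := by positivity
  calc (4 * K + 1) * (pN * (q : ℝ) ^ a * (q : ℝ) ^ s)
      ≤ (5 * K) * (pN * (q : ℝ) ^ a * (q : ℝ) ^ s) := by gcongr; linarith
    _ = (5 * K) * (pN * (q : ℝ) ^ a * (q : ℝ) ^ s) * 1 := (mul_one _).symm
    _ ≤ (5 * K) * (pN * (q : ℝ) ^ a * (q : ℝ) ^ s) * (8 * (q : ℝ) ^ h) := by gcongr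
    _ = _ := by
      rw [pow_add, pow_add]
      ring

end PartitionDecay

section PartitionDecayIteration

theorem IsBoltzmannParameter.decay_iterate {N : ℕ} {q : unitInterval} {x y : ℝ}
    (hB : IsBoltzmannParameter N q x) (hx1 : x ≤ 1) (hy : 4 ≤ y)
    (hbig : (N : ℝ) ^ 5 * Real.exp (-2 * (Real.exp (-y) / x)) ≤ Real.exp (-y)) (k : ℕ) :
    ∀ t ≤ N, x * t ≤ k * y → (Fintype.card (Nat.Partition (N - t)) : ℝ)
      ≤ 40 ^ k * (Fintype.card (Nat.Partition N) * (q : ℝ) ^ t) := by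
  have hx := hB.pos
  have hpow : ∀ j : ℕ, (q : ℝ) ^ j = Real.exp (-(x * j)) := by
    intro j
    rw [hB.eq_exp, ← Real.exp_nat_mul]
    ring_nf
  have hq0 : (0 : ℝ) < q := by
    rw [hB.eq_exp]
    exact Real.exp_pos _
  set pN : ℝ := (Fintype.card (Nat.Partition N) : ℝ) with hpN
  induction k with
  | zero =>
    intro t _ ht
    rw [Nat.cast_zero, zero_mul] at ht
    have h0 : (t : ℝ) ≤ 0 := by
      by_contra! h
      nlinarith
    have h1 : t = 0 := by exact_mod_cast le_antisymm h0 t.cast_nonneg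
    rw [h1]
    simp [hpN]
  | succ k ih =>
    intro t htN ht
    set h := ⌈1 / x⌉₊ with hh
    have hh1 : 1 / x ≤ h := Nat.le_ceil _
    have hh2 : (h : ℝ) < 1 / x + 1 := Nat.ceil_lt_add_one (by positivity)
    have hxh1 : 1 ≤ x * h := by
      rw [div_le_iff₀ hx] at hh1
      linarith
    have hxh2 : x * h ≤ 1 + x := by
      have := mul_lt_mul_of_pos_left hh2 hx
      rw [mul_add, mul_one_div_cancel hx.ne', mul_one] at this
      exact this.le
    have hpos : 1 ≤ h := Nat.ceil_pos.2 (by positivity)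
    rcases le_or_gt t h with hth | hth
    · have h1 : (Fintype.card (Nat.Partition (N - t)) : ℝ) ≤ pN := by
        rw [hpN]
        exact_mod_cast card_partition_mono (Nat.sub_le N t)
      have h2 : 1 ≤ 40 * (q : ℝ) ^ t := by
        rw [hpow]
        have h3 : Real.exp (x * t) ≤ 40 := by
          have h4 : (t : ℝ) ≤ h := by exact_mod_cast hth
          have h5 : x * t ≤ 1 + 1 := by nlinarith
          refine (Real.exp_le_exp.2 h5).trans ?_
          rw [Real.exp_add]
          have := Real.exp_one_lt_d9
          nlinarith [Real.exp_pos 1]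
        rw [Real.exp_neg, ← div_eq_mul_inv, le_div_iff₀ (Real.exp_pos _), one_mul]
        exact h3
      have h3 : (1 : ℝ) ≤ 40 ^ k := one_le_pow₀ (by norm_num)
      have hpN0 : 0 ≤ pN := by positivity
      calc (Fintype.card (Nat.Partition (N - t)) : ℝ) ≤ pN := h1
        _ = 1 * (pN * 1) := by ring
        _ ≤ 40 ^ k * (pN * (40 * (q : ℝ) ^ t)) := by gcongr
        _ = _ := by ring
    · set c := ⌈y / x⌉₊ with hc
      have hc1 : y / x ≤ c := Nat.le_ceil _
      have hc2 : (c : ℝ) < y / x + 1 := Nat.ceil_lt_add_one (by positivity)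
      have hxc1 : y ≤ x * c := by
        rw [div_le_iff₀ hx] at hc1
        linarith
      have hxc2 : x * c ≤ y + x := by
        have := mul_lt_mul_of_pos_left hc2 hx
        rw [mul_add, mul_div_cancel₀ _ hx.ne', mul_one] at this
        exact this.le
      have hch : h + 1 ≤ c := by
        have h1 : (h : ℝ) < c := by
          refine lt_of_mul_lt_mul_left (a := x) ?_ hx.le
          linarith
        exact_mod_cast h1
      set m := min t c with hm
      have hmt : m ≤ t := min_le_left _ _
      have hmc : m ≤ c := min_le_right _ _
      have hmh : h + 1 ≤ m := le_min hth hch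
      have hs2 : ((m - h : ℕ) : ℝ) = m - h := by
        rw [Nat.cast_sub (by omega)]
      have hmc' : (m : ℝ) ≤ c := by exact_mod_cast hmc
      have hxs : x * ((m - h : ℕ) : ℝ) ≤ y := by
        rw [hs2]
        nlinarith
      have hqs : Real.exp (-y) ≤ (q : ℝ) ^ (m - h) := by
        rw [hpow, Real.exp_le_exp]
        linarith
      have hxa : x * ((t - m : ℕ) : ℝ) ≤ k * y := by
        rw [Nat.cast_sub hmt]
        rcases le_total t c with htc | htc
        · have : m = t := min_eq_left htc
          rw [this, sub_self, mul_zero]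
          positivity
        · have : m = c := min_eq_right htc
          rw [this]
          push_cast at ht
          nlinarith
      have hstep := hB.decay_step (a := t - m) (s := m - h) (h := h) (K := 40 ^ k) (by omega) hpos
        (by omega) (one_le_pow₀ (by norm_num)) (by linarith) ?_ (ih (t - m) (by omega) hxa)
      · have e : t - m + (m - h) + h = t := by omega
        rw [e] at hstep
        rw [pow_succ']
        exact hstep
      · have h1 : Real.exp (-y) / x = 1 / x * Real.exp (-y) := by ring
        have h2 : 1 / x * Real.exp (-y) ≤ h * (q : ℝ) ^ (m - h) := by gcongr
        refine le_trans ?_ (hbig.trans hqs)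
        rw [h1]
        exact mul_le_mul_of_nonneg_left (Real.exp_le_exp.2 (by linarith)) (by positivity)

theorem tendsto_log_natCast_atTop :
    Filter.Tendsto (fun N : ℕ => Real.log N) Filter.atTop Filter.atTop :=
  Real.tendsto_log_atTop.comp tendsto_natCast_atTop_atTop

theorem eventually_mul_pow_le_exp (c : ℝ) (k : ℕ) {b : ℝ} (hb : 0 < b) :
    ∀ᶠ ℓ : ℝ in Filter.atTop, c * ℓ ^ k ≤ Real.exp (b * ℓ) := by
  have h := (isLittleO_pow_exp_pos_mul_atTop k hb).bound (show (0 : ℝ) < 1 / (|c| + 1) by positivity)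
  filter_upwards [h, Filter.eventually_ge_atTop 0] with ℓ h1 h2
  rw [Real.norm_of_nonneg (by positivity), Real.norm_of_nonneg (Real.exp_pos _).le, one_div,
    ← div_eq_inv_mul, le_div_iff₀ (by positivity)] at h1
  have h3 : 0 ≤ ℓ ^ k := by positivity
  nlinarith [le_abs_self c]

/-- For large `N` the number of partitions of `N - t` decays exponentially in `t`. -/
theorem exists_boltzmann_parameter_decay :
    ∀ᶠ N : ℕ in Filter.atTop, ∃ (q : unitInterval) (x : ℝ), IsBoltzmannParameter N q x ∧
      ∀ t ≤ N, (Fintype.card (Nat.Partition (N - t)) : ℝ)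
        ≤ 40 * Fintype.card (Nat.Partition N) * Real.exp (-(x * (1 - 10 / Real.log N))) ^ t := by
  have hE : ∀ᶠ ℓ : ℝ in Filter.atTop, 10 ≤ ℓ ∧ 11 * ℓ ^ 2 ≤ Real.exp (1 / 10 * ℓ) ∧
      4 * ℓ ^ 1 ≤ Real.exp (1 / 2 * ℓ) :=
    (Filter.eventually_ge_atTop 10).and ((eventually_mul_pow_le_exp 11 2 (by norm_num)).and
      (eventually_mul_pow_le_exp 4 1 (by norm_num)))
  filter_upwards [exists_boltzmann_parameter, tendsto_log_natCast_atTop.eventually hE,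
    Filter.eventually_ge_atTop 1] with N ⟨q, x, hx, hqx, hup, hlow, hw⟩ ⟨hl10, hl2, hl1⟩ hN1
  have hB : IsBoltzmannParameter N q x := ⟨hx, hqx, hup, hlow, hw⟩
  refine ⟨q, x, hB, ?_⟩
  have hN0 : (0 : ℝ) < N := by exact_mod_cast hN1
  set ℓ := Real.log N with hℓ
  have hexp : Real.exp ℓ = N := Real.exp_log hN0
  have hsqrt : √(N : ℝ) = Real.exp (1 / 2 * ℓ) := by
    rw [Real.sqrt_eq_rpow, Real.rpow_def_of_pos hN0, mul_comm]
  rw [hsqrt] at hup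
  set y := 2 / 5 * ℓ with hy
  have hx1 : x ≤ 1 := by
    rw [pow_one] at hl1
    have h1 : x * Real.exp (1 / 2 * ℓ) ≤ 1 * Real.exp (1 / 2 * ℓ) := by linarith
    exact le_of_mul_le_mul_right h1 (Real.exp_pos _)
  have hbig : (N : ℝ) ^ 5 * Real.exp (-2 * (Real.exp (-y) / x)) ≤ Real.exp (-y) := by
    have h1 : 11 / 4 * ℓ ≤ Real.exp (-y) / x := by
      rw [le_div_iff₀ hx]
      have e1 : Real.exp (-y) = Real.exp (1 / 10 * ℓ) * Real.exp (-(1 / 2 * ℓ)) := by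
        rw [← Real.exp_add]
        congr 1
        rw [hy]
        ring
      have e2 : x ≤ 4 * ℓ * Real.exp (-(1 / 2 * ℓ)) := by
        rw [Real.exp_neg, ← div_eq_mul_inv, le_div_iff₀ (Real.exp_pos _)]
        exact hup
      calc 11 / 4 * ℓ * x ≤ 11 / 4 * ℓ * (4 * ℓ * Real.exp (-(1 / 2 * ℓ))) := by gcongr
        _ = 11 * ℓ ^ 2 * Real.exp (-(1 / 2 * ℓ)) := by ring
        _ ≤ _ := by
          rw [e1]
          gcongr
    rw [← hexp, ← Real.exp_nat_mul, ← Real.exp_add, Real.exp_le_exp]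
    push_cast
    rw [hy]
    linarith
  intro t ht
  have hy0 : 0 < y := by
    rw [hy]
    linarith
  set k := ⌈x * t / y⌉₊ with hk
  have hk1 : x * t / y ≤ k := Nat.le_ceil _
  have hk2 : (k : ℝ) < x * t / y + 1 := Nat.ceil_lt_add_one (by positivity)
  have h1 := hB.decay_iterate hx1 (y := y) (by rw [hy]; linarith) hbig k t ht
    ((div_le_iff₀ hy0).1 hk1)
  refine h1.trans ?_
  have h40 : (40 : ℝ) ≤ Real.exp 4 := by
    have h3 : (40 : ℝ) ≤ 2.7 ^ 4 := by norm_num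
    have h4 : Real.exp 4 = Real.exp 1 ^ 4 := by
      rw [← Real.exp_nat_mul]
      norm_num
    rw [h4]
    refine h3.trans ?_
    gcongr
    have := Real.exp_one_gt_d9
    linarith
  have hk40 : (40 : ℝ) ^ k ≤ 40 * Real.exp (4 * (x * t / y)) := by
    rw [← Real.rpow_natCast]
    calc (40 : ℝ) ^ (k : ℝ) ≤ 40 ^ (x * t / y + 1) :=
          Real.rpow_le_rpow_of_exponent_le (by norm_num) hk2.le
      _ = 40 * 40 ^ (x * t / y) := by
          rw [Real.rpow_add (by norm_num), Real.rpow_one, mul_comm]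
      _ ≤ 40 * Real.exp 4 ^ (x * t / y) := by gcongr
      _ = _ := by rw [← Real.exp_mul]
  calc (40 : ℝ) ^ k * (Fintype.card (Nat.Partition N) * (q : ℝ) ^ t)
      ≤ 40 * Real.exp (4 * (x * t / y)) * (Fintype.card (Nat.Partition N) * (q : ℝ) ^ t) := by
        have := q.2.1
        gcongr
    _ = 40 * Fintype.card (Nat.Partition N) * (Real.exp (4 * (x * t / y)) * (q : ℝ) ^ t) := by ring
    _ = _ := by
      rw [hqx, ← Real.exp_nat_mul, ← Real.exp_nat_mul, ← Real.exp_add]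
      congr 2
      rw [hy]
      field_simp
      ring

end PartitionDecayIteration

section MergeEvents

open MeasureTheory ProbabilityTheory

theorem iIndepFun_eval_boltzmannMeasure (q : unitInterval) (N : ℕ) :
    iIndepFun (fun (i : Fin N) (v : Fin N → ℕ) => v i) (boltzmannMeasure q N) :=
  iIndepFun_pi (X := fun _ n => n) fun _ => measurable_id.aemeasurable

/-- Events depending on disjoint sets of coordinates are independent. -/
theorem boltzmannMeasure_real_inter {q : unitInterval} {N : ℕ} {S T : Finset (Fin N)}
    (hST : Disjoint S T) {A B : Set (Fin N → ℕ)} (hA : DependsOn (· ∈ A) (S : Set (Fin N)))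
    (hB : DependsOn (· ∈ B) (T : Set (Fin N))) :
    (boltzmannMeasure q N).real (A ∩ B)
      = (boltzmannMeasure q N).real A * (boltzmannMeasure q N).real B := by
  have h := (iIndepFun_eval_boltzmannMeasure q N).indepFun_finset S T hST
    fun i => measurable_pi_apply i
  have key : ∀ {S : Finset (Fin N)} {A : Set (Fin N → ℕ)}, DependsOn (· ∈ A) (S : Set (Fin N)) →
      A = (fun v (i : S) => v i) ⁻¹' (Set.image (fun v (i : S) => v i) A) := by
    intro S A hA
    refine (Set.subset_preimage_image _ _).antisymm ?_
    rintro v ⟨w, hw, hwv⟩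
    have h1 : (w ∈ A) = (v ∈ A) := hA fun i hi => congrFun hwv ⟨i, hi⟩
    rwa [← h1]
  rw [key hA, key hB, measureReal_def, measureReal_def, measureReal_def, ← ENNReal.toReal_mul]
  congr 1
  exact h.measure_inter_preimage_eq_mul _ _ MeasurableSet.of_discrete MeasurableSet.of_discrete

/-- The probability that none of several independent events occurs. -/
theorem boltzmannMeasure_real_forall_notMem_le {ι : Type*} {q : unitInterval} {N : ℕ}
    (I : Finset ι) (D : ι → Finset (Fin N)) (U : ι → Set (Fin N → ℕ))
    (hD : ∀ u ∈ I, ∀ w ∈ I, u ≠ w → Disjoint (D u) (D w))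
    (hU : ∀ u ∈ I, DependsOn (· ∈ U u) (D u : Set (Fin N))) :
    (boltzmannMeasure q N).real {v | ∀ u ∈ I, v ∉ U u}
      ≤ Real.exp (-∑ u ∈ I, (boltzmannMeasure q N).real (U u)) := by
  classical
  induction I using Finset.induction_on with
  | empty => simp
  | insert a I ha ih =>
    have e : {v : Fin N → ℕ | ∀ u ∈ insert a I, v ∉ U u}
        = (U a)ᶜ ∩ {v | ∀ u ∈ I, v ∉ U u} := by
      ext v
      simp
    have h1 : DependsOn (· ∈ (U a)ᶜ) (D a : Set (Fin N)) := by
      intro v w hvw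
      have := hU a (Finset.mem_insert_self a I) hvw
      simp only [Set.mem_compl_iff]
      simp only at this
      rw [this]
    have h2 : DependsOn (· ∈ {v : Fin N → ℕ | ∀ u ∈ I, v ∉ U u})
        (I.biUnion D : Set (Fin N)) := by
      intro v w hvw
      simp only [Set.mem_ofPred_eq, eq_iff_iff]
      refine forall₂_congr fun u hu => ?_
      have := hU u (Finset.mem_insert_of_mem hu) fun i hi =>
        hvw i (Finset.mem_coe.2 (Finset.mem_biUnion.2 ⟨u, hu, Finset.mem_coe.1 hi⟩))
      simp only at this
      rw [this]
    have hdisj : Disjoint (D a) (I.biUnion D) := by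
      rw [Finset.disjoint_biUnion_right]
      intro u hu
      exact hD a (Finset.mem_insert_self a I) u (Finset.mem_insert_of_mem hu)
        fun h => ha (h ▸ hu)
    rw [e, boltzmannMeasure_real_inter hdisj h1 h2, Finset.sum_insert ha, neg_add, Real.exp_add]
    refine mul_le_mul ?_ (ih (fun u hu w hw => hD u (Finset.mem_insert_of_mem hu) w
      (Finset.mem_insert_of_mem hw)) fun u hu => hU u (Finset.mem_insert_of_mem hu))
      measureReal_nonneg (Real.exp_pos _).le
    rw [probReal_compl_eq_one_sub MeasurableSet.of_discrete]
    have := Real.add_one_le_exp (-(boltzmannMeasure q N).real (U a))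
    linarith

/-- The multiplicities `v (β 0), …, v (β J)` of the parts `m, m * p, …, m * p ^ J` allow to
collect parts of total size `m * p ^ k`, using all parts but those of size `m`. -/
def mergeEvent {N J : ℕ} (p k : ℕ) (β : Fin (J + 1) → Fin N) : Set (Fin N → ℕ) :=
  {v | ∑ j : Fin J, v (β j.succ) * p ^ (j.val + 1) ≤ p ^ k ∧
    p ^ k ≤ v (β 0) + ∑ j : Fin J, v (β j.succ) * p ^ (j.val + 1)}

theorem dependsOn_mergeEvent {N J : ℕ} (p k : ℕ) (β : Fin (J + 1) → Fin N) :
    DependsOn (· ∈ mergeEvent p k β) ((Finset.univ.image β : Finset (Fin N)) : Set (Fin N)) := by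
  intro v w h
  have h1 : ∀ j, v (β j) = w (β j) := fun j => h _ (by simp)
  simp only [mergeEvent, Set.mem_ofPred_eq, h1]

theorem sum_replicate_le {ι : Type*} [DecidableEq ι] (I : Finset ι) {e r : ι → ℕ} {M : Multiset ℕ}
    (he : ∀ i ∈ I, ∀ j ∈ I, e i = e j → i = j) (hr : ∀ i ∈ I, r i ≤ M.count (e i)) :
    ∑ i ∈ I, Multiset.replicate (r i) (e i) ≤ M := by
  rw [Multiset.le_iff_count]
  intro d
  rw [Multiset.count_sum']
  simp only [Multiset.count_replicate]
  by_cases hd : ∃ i ∈ I, e i = d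
  · obtain ⟨i, hi, rfl⟩ := hd
    rw [Finset.sum_eq_single_of_mem i hi fun j hj hji => if_neg fun h => hji (he j hj i hi h),
      if_pos rfl]
    exact hr i hi
  · rw [Finset.sum_eq_zero fun i hi => if_neg fun h => hd ⟨i, hi, h⟩]
    exact Nat.zero_le _

theorem hasMergeableParts_of_mem_mergeEvent {N n J p k m s : ℕ} {β : Fin (J + 1) → Fin N}
    (hp : 1 < p) (hm : m.Coprime p) (hm0 : 0 < m) (hJk : J ≤ k)
    (hβ : ∀ j, (β j).val + 1 = m * p ^ j.val) (hs : s ≤ m * p ^ k) {ν : Nat.Partition n}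
    (h : multiplicities N ν ∈ mergeEvent p k β) : HasMergeableParts p s ν.parts := by
  obtain ⟨h1, h2⟩ := h
  set v := multiplicities N ν with hv
  set t := ∑ j : Fin J, v (β j.succ) * p ^ (j.val + 1) with hS
  set r : Fin (J + 1) → ℕ := Fin.cons (p ^ k - t) fun j => v (β j.succ) with hr
  have hle : ∑ j : Fin (J + 1), Multiset.replicate (r j) (m * p ^ j.val) ≤ ν.parts := by
    refine sum_replicate_le _ (fun i _ j _ hij => ?_) fun j _ => ?_
    · exact Fin.ext (Nat.pow_right_injective hp (Nat.eq_of_mul_eq_mul_left hm0 hij))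
    · have h3 : v (β j) = ν.parts.count (m * p ^ j.val) := by
        rw [← hβ j]
        rfl
      rw [← h3]
      refine Fin.cases ?_ (fun j => ?_) j
      · simp only [hr, Fin.cons_zero]
        omega
      · simp [hr]
  refine ⟨m, k, _, ν.parts - ∑ j : Fin (J + 1), Multiset.replicate (r j) (m * p ^ j.val), hm,
    (add_tsub_cancel_of_le hle).symm, ?_, hs, ?_⟩
  · rw [Multiset.sum_sum]
    simp only [Multiset.sum_replicate, smul_eq_mul]
    rw [Fin.sum_univ_succ]
    simp only [hr, Fin.cons_zero, Fin.cons_succ, Fin.val_zero, pow_zero, mul_one, Fin.val_succ]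
    have h3 : ∑ j : Fin J, v (β j.succ) * (m * p ^ (j.val + 1)) = t * m := by
      rw [hS, Finset.sum_mul]
      exact Finset.sum_congr rfl fun j _ => by ring
    rw [h3, ← add_mul, Nat.sub_add_cancel h1, mul_comm]
  · intro d hd
    obtain ⟨j, -, hj⟩ := Multiset.mem_sum.1 hd
    exact ⟨j.val, by omega, Multiset.eq_of_mem_replicate hj⟩

theorem le_boltzmannMeasure_real_mergeEvent {N J p k m : ℕ} {q : unitInterval} (hq : q < 1)
    {β : Fin (J + 1) → Fin N} (hJ : 1 ≤ J) (hJk : J ≤ k) (hp : 1 < p) (hm0 : 0 < m)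
    (hβ : ∀ j, (β j).val + 1 = m * p ^ j.val) :
    (q : ℝ) ^ (m * p ^ k) *
      ∏ j : Fin J, ((p : ℝ) ^ (k - (j.val + 1)) / J * (1 - (q : ℝ) ^ (m * p ^ (j.val + 1))))
      ≤ (boltzmannMeasure q N).real (mergeEvent p k β) := by
  classical
  have hq0 : (0 : ℝ) ≤ q := q.2.1
  have hq1 : (q : ℝ) ≤ 1 := q.2.2
  have hβi : Function.Injective β := by
    intro i j hij
    have h1 : m * p ^ i.val = m * p ^ j.val := by rw [← hβ, ← hβ, hij]
    exact Fin.ext (Nat.pow_right_injective hp (Nat.eq_of_mul_eq_mul_left hm0 h1))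
  set C : Finset (Fin J → ℕ) :=
    Fintype.piFinset fun j => Finset.range (p ^ (k - (j.val + 1)) / J + 1) with hC
  set tot : (Fin J → ℕ) → ℕ := fun c => ∑ j : Fin J, c j * p ^ (j.val + 1) with htot
  set box : (Fin J → ℕ) → Set (Fin N → ℕ) :=
    fun c => {v | (∀ j : Fin J, v (β j.succ) = c j) ∧ p ^ k - tot c ≤ v (β 0)} with hbox
  have hle : ∀ c ∈ C, tot c ≤ p ^ k := by
    intro c hc
    have h1 : ∀ j : Fin J, c j * p ^ (j.val + 1) ≤ p ^ k / J := by
      intro j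
      have h2 := (Finset.mem_range.1 (Fintype.mem_piFinset.1 hc j))
      have h3 : c j ≤ p ^ (k - (j.val + 1)) / J := by omega
      rw [Nat.le_div_iff_mul_le (by omega)] at h3 ⊢
      have h4 : p ^ k = p ^ (k - (j.val + 1)) * p ^ (j.val + 1) := by
        rw [← pow_add]
        congr 1
        have := j.2
        omega
      rw [h4]
      calc c j * p ^ (j.val + 1) * J = c j * J * p ^ (j.val + 1) := by ring
        _ ≤ _ := Nat.mul_le_mul_right _ h3
    refine (Finset.sum_le_card_nsmul _ _ _ fun j _ => h1 j).trans ?_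
    rw [Finset.card_univ, Fintype.card_fin, smul_eq_mul]
    exact Nat.mul_div_le _ _
  have hsub : (⋃ c ∈ C, box c) ⊆ mergeEvent p k β := by
    intro v hv
    simp only [Set.mem_iUnion] at hv
    obtain ⟨c, hc, h1, h2⟩ := hv
    have h3 : ∑ j : Fin J, v (β j.succ) * p ^ (j.val + 1) = tot c := by
      simp only [h1, htot]
    have h4 := hle c hc
    simp only [mergeEvent, Set.mem_ofPred_eq, h3]
    omega
  have hdis : Set.PairwiseDisjoint (C : Set (Fin J → ℕ)) box := by
    intro c _ d _ hcd
    rw [Function.onFun, Set.disjoint_left]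
    rintro v ⟨h1, -⟩ ⟨h2, -⟩
    exact hcd (funext fun j => (h1 j).symm.trans (h2 j))
  have hprob : ∀ c ∈ C, (boltzmannMeasure q N).real (box c)
      = (q : ℝ) ^ (m * p ^ k) * ∏ j : Fin J, (1 - (q : ℝ) ^ (m * p ^ (j.val + 1))) := by
    intro c hc
    set s : Fin (J + 1) → Set ℕ := Fin.cons {n | p ^ k - tot c ≤ n} fun j => {c j} with hs
    have hb : box c = ⋂ j ∈ (Finset.univ : Finset (Fin (J + 1))),
        (fun v : Fin N → ℕ => v (β j)) ⁻¹' s j := by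
      ext v
      simp only [hbox, Set.mem_ofPred_eq, Finset.mem_univ, Set.iInter_true, Set.mem_iInter,
        Set.mem_preimage]
      rw [Fin.forall_fin_succ]
      simp [hs, and_comm]
    have hind := ((iIndepFun_eval_boltzmannMeasure q N).precomp hβi).measure_inter_preimage_eq_mul
      Finset.univ (sets := s) fun j _ => MeasurableSet.of_discrete
    have h1 : ∀ j, (boltzmannMeasure q N).real ((fun v : Fin N → ℕ => v (β j)) ⁻¹' s j)
        = (geometricMeasure (unitInterval.symm (q ^ ((β j).val + 1)))).real (s j) := fun j =>
      boltzmannMeasure_real_apply (β j) (s j)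
    rw [measureReal_def, hb]
    refine (congrArg ENNReal.toReal hind).trans ?_
    rw [ENNReal.toReal_prod]
    refine (Finset.prod_congr rfl fun j _ => h1 j).trans ?_
    rw [Fin.prod_univ_succ]
    simp only [hs, Fin.cons_zero, Fin.cons_succ]
    rw [geometricMeasure_real_le hq, hβ]
    simp only [geometricMeasure_real_singleton (symm_pow_ne_zero hq _), unitInterval.coe_symm_eq]
    push_cast
    simp only [sub_sub_cancel, ← pow_mul, hβ, Finset.prod_mul_distrib]
    rw [Finset.prod_pow_eq_pow_sum, ← mul_assoc, ← pow_add]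
    congr 2
    simp only [Fin.val_zero, pow_zero, mul_one, Fin.val_succ]
    have h2 : ∑ j : Fin J, m * p ^ (j.val + 1) * c j = m * tot c := by
      rw [htot, Finset.mul_sum]
      exact Finset.sum_congr rfl fun j _ => by ring
    rw [h2, ← mul_add, Nat.sub_add_cancel (hle c hc)]
  have hsum : (boltzmannMeasure q N).real (⋃ c ∈ C, box c)
      = C.card * ((q : ℝ) ^ (m * p ^ k) *
        ∏ j : Fin J, (1 - (q : ℝ) ^ (m * p ^ (j.val + 1)))) := by
    rw [measureReal_biUnion_finset hdis fun _ _ => MeasurableSet.of_discrete,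
      Finset.sum_congr rfl hprob, Finset.sum_const, nsmul_eq_mul]
  refine le_trans ?_ (measureReal_mono hsub)
  rw [hsum, hC, Fintype.card_piFinset]
  simp only [Finset.card_range]
  rw [Finset.prod_mul_distrib, ← mul_assoc, mul_comm ((q : ℝ) ^ (m * p ^ k)), mul_assoc]
  refine mul_le_mul_of_nonneg_right ?_ (mul_nonneg (by positivity)
    (Finset.prod_nonneg fun j _ => sub_nonneg.2 (pow_le_one₀ hq0 hq1)))
  push_cast
  refine Finset.prod_le_prod (fun j _ => by positivity) fun j _ => ?_
  have := Nat.lt_div_mul_add (a := p ^ (k - (j.val + 1))) (b := J) (by omega)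
  rw [div_le_iff₀ (by positivity)]
  have h2 : p ^ (k - (j.val + 1)) ≤ (p ^ (k - (j.val + 1)) / J + 1) * J := by
    rw [add_mul]
    omega
  exact_mod_cast h2

/-- A lower bound for the probability of a merge event. -/
theorem exp_mul_pow_le_boltzmannMeasure_real_mergeEvent {N J p k m : ℕ} {q : unitInterval} {x : ℝ}
    (hx : 0 < x) (hqx : (q : ℝ) = Real.exp (-x))
    {β : Fin (J + 1) → Fin N} (hJ : 1 ≤ J) (hJk : J ≤ k) (hp : 1 < p) (hm0 : 0 < m)
    (hβ : ∀ j, (β j).val + 1 = m * p ^ j.val) (hsmall : x * (m * p ^ J) ≤ 1 / 2) :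
    Real.exp (-(x * (m * p ^ k))) * (3 * (x * (m * p ^ k)) / (4 * J)) ^ J
      ≤ (boltzmannMeasure q N).real (mergeEvent p k β) := by
  have hq1 : q < 1 := by
    have h1 : (q : ℝ) < 1 := by
      rw [hqx, Real.exp_lt_one_iff]
      linarith
    exact h1
  have hJ0 : (0 : ℝ) < J := by exact_mod_cast hJ
  refine le_trans ?_ (le_boltzmannMeasure_real_mergeEvent hq1 hJ hJk hp hm0 hβ)
  have hpow : ∀ j : ℕ, (q : ℝ) ^ j = Real.exp (-(x * j)) := by
    intro j
    rw [hqx, ← Real.exp_nat_mul]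
    ring_nf
  rw [hpow]
  push_cast
  refine mul_le_mul_of_nonneg_left ?_ (Real.exp_pos _).le
  have hc : (3 * (x * (m * p ^ k)) / (4 * J)) ^ J
      = ∏ _j : Fin J, (3 * (x * (m * p ^ k)) / (4 * J) : ℝ) := by
    rw [Finset.prod_const, Finset.card_univ, Fintype.card_fin]
  rw [hc]
  refine Finset.prod_le_prod (fun j _ => by positivity) fun j _ => ?_
  set u : ℝ := x * (m * p ^ (j.val + 1)) with hu
  have hu0 : 0 ≤ u := by positivity
  have hp1 : (1 : ℝ) ≤ p := by exact_mod_cast hp.le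
  have hu1 : u ≤ 1 / 2 := by
    refine le_trans ?_ hsmall
    rw [hu]
    have h1 : (p : ℝ) ^ (j.val + 1) ≤ p ^ J := pow_le_pow_right₀ hp1 (by omega)
    gcongr
  have hexp : 3 / 4 * u ≤ 1 - Real.exp (-u) := by
    have h1 := Real.quadratic_le_exp_of_nonneg hu0
    have h2 : Real.exp (-u) ≤ 1 / (1 + u + u ^ 2 / 2) := by
      rw [Real.exp_neg, ← one_div]
      exact one_div_le_one_div_of_le (by positivity) h1
    have h3 : 1 / (1 + u + u ^ 2 / 2) ≤ 1 - 3 / 4 * u := by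
      rw [div_le_iff₀ (by positivity)]
      nlinarith [mul_nonneg hu0 (sub_nonneg.2 hu1), mul_nonneg hu0 (mul_nonneg hu0 hu0),
        mul_nonneg (mul_nonneg hu0 hu0) (sub_nonneg.2 hu1)]
    linarith
  rw [hpow]
  push_cast
  have e : (3 * (x * (m * p ^ k)) / (4 * J) : ℝ) = p ^ (k - (j.val + 1)) / J * (3 / 4 * u) := by
    have h4 : (p : ℝ) ^ k = p ^ (k - (j.val + 1)) * p ^ (j.val + 1) := by
      rw [← pow_add]
      congr 1
      have := j.2
      omega
    rw [hu, h4]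
    field_simp
  rw [e]
  gcongr

end MergeEvents

section UnmergeablePartitions

open MeasureTheory ProbabilityTheory

theorem eq_of_mul_pow_eq_mul_pow {p m n i j : ℕ} (hp : 0 < p) (hm : m.Coprime p)
    (hn : n.Coprime p) (h : m * p ^ i = n * p ^ j) : m = n := by
  have h1 : p ^ i ∣ p ^ j :=
    (Nat.Coprime.pow_right i hn).symm.dvd_of_dvd_mul_left (h ▸ Dvd.intro_left m rfl)
  have h2 : p ^ j ∣ p ^ i :=
    (Nat.Coprime.pow_right j hm).symm.dvd_of_dvd_mul_left (h ▸ Dvd.intro_left n rfl)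
  rw [Nat.dvd_antisymm h1 h2] at h
  exact Nat.eq_of_mul_eq_mul_right (by positivity) h

/-- Few partitions do not have mergeable parts. -/
theorem IsBoltzmannParameter.card_not_hasMergeableParts_le {N p s J k n : ℕ} {q : unitInterval}
    {x : ℝ} (hB : IsBoltzmannParameter N q x) (hp : 1 < p) (hJ : 1 ≤ J) (hJk : J ≤ k)
    (hn : x * ((n + 2) * p ^ (k + 1)) ≤ 1) (hJs : 4 * J * p ≤ x * s)
    (hk : 2 * (x * s + 1) * p ^ J ≤ p ^ k) (hxN : 1 ≤ 2 * x * N) :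
    (Nat.card {ν : Nat.Partition N // ¬ HasMergeableParts p s ν.parts} : ℝ)
      ≤ (N : ℝ) ^ 5 * Fintype.card (Nat.Partition N) *
        Real.exp (-(n * (Real.exp (-(x * s + 1)) * (3 * p) ^ J))) := by
  classical
  have hx := hB.pos
  have hN : 0 < N := by
    rcases Nat.eq_zero_or_pos N with rfl | h
    · norm_num at hxN
    · exact h
  have hJ0 : (0 : ℝ) < J := by exact_mod_cast hJ
  have hp0 : (0 : ℝ) < p := by exact_mod_cast (by omega : 0 < p)
  set I := Finset.Ico (s / p ^ (k + 1) + 1) (s / p ^ (k + 1) + 1 + n) with hI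
  set β : ℕ → Fin (J + 1) → Fin N :=
    fun u j => ⟨((p * u + 1) * p ^ j.val - 1) % N, Nat.mod_lt _ hN⟩ with hβdef
  have hcop : ∀ u : ℕ, (p * u + 1).Coprime p := fun u => by simp
  have hlow : ∀ u ∈ I, s ≤ (p * u + 1) * p ^ k := by
    intro u hu
    have h1 : s / p ^ (k + 1) < u := (Finset.mem_Ico.1 hu).1
    rw [Nat.div_lt_iff_lt_mul (by positivity)] at h1
    calc s ≤ u * p ^ (k + 1) := h1.le
      _ = (p * u) * p ^ k := by ring
      _ ≤ _ := Nat.mul_le_mul_right _ (by omega)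
  have hup : ∀ u ∈ I, x * ((p * u + 1 : ℕ) * p ^ k) ≤ x * s + 1 := by
    intro u hu
    have h1 : u ≤ s / p ^ (k + 1) + n := by
      have := (Finset.mem_Ico.1 hu).2
      omega
    have h2 : s / p ^ (k + 1) * p ^ (k + 1) ≤ s := Nat.div_mul_le_self _ _
    have h3 : (p * u + 1) * p ^ k ≤ s + (n + 2) * p ^ (k + 1) := by
      have h4 : p ^ k ≤ p ^ (k + 1) := Nat.pow_le_pow_right (by omega) (by omega)
      calc (p * u + 1) * p ^ k = u * p ^ (k + 1) + p ^ k := by ring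
        _ ≤ (s / p ^ (k + 1) + n) * p ^ (k + 1) + p ^ (k + 1) := by gcongr
        _ = s / p ^ (k + 1) * p ^ (k + 1) + (n + 1) * p ^ (k + 1) := by ring
        _ ≤ s + (n + 2) * p ^ (k + 1) := by gcongr; omega
    have h5 : ((p * u + 1 : ℕ) * p ^ k : ℝ) ≤ s + (n + 2) * p ^ (k + 1) := by exact_mod_cast h3
    calc x * ((p * u + 1 : ℕ) * p ^ k) ≤ x * (s + (n + 2) * p ^ (k + 1)) := by gcongr
      _ = x * s + x * ((n + 2) * p ^ (k + 1)) := by ring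
      _ ≤ _ := by linarith
  have hsmall : ∀ u ∈ I, x * ((p * u + 1 : ℕ) * p ^ J) ≤ 1 / 2 := by
    intro u hu
    have h1 : x * ((p * u + 1 : ℕ) * p ^ J) * p ^ k ≤ 1 / 2 * p ^ k := by
      calc x * ((p * u + 1 : ℕ) * p ^ J) * p ^ k
          = x * ((p * u + 1 : ℕ) * p ^ k) * p ^ J := by ring
        _ ≤ (x * s + 1) * p ^ J := by
          gcongr
          exact hup u hu
        _ ≤ _ := by linarith
    exact le_of_mul_le_mul_right h1 (by positivity)
  have hβ : ∀ u ∈ I, ∀ j, (β u j).val + 1 = (p * u + 1) * p ^ j.val := by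
    intro u hu j
    have h1 : (p * u + 1) * p ^ j.val ≤ N := by
      have h2 : x * ((p * u + 1 : ℕ) * p ^ J) ≤ x * N := by
        have := hsmall u hu
        linarith
      have h3 : ((p * u + 1 : ℕ) * p ^ J : ℝ) ≤ N := le_of_mul_le_mul_left h2 hx
      have h4 : (p * u + 1) * p ^ J ≤ N := by exact_mod_cast h3
      refine le_trans (Nat.mul_le_mul_left _ (Nat.pow_le_pow_right (by omega) ?_)) h4
      have := j.2
      omega
    have h5 : 0 < (p * u + 1) * p ^ j.val := by positivity
    simp only [hβdef]
    rw [Nat.mod_eq_of_lt (by omega)]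
    omega
  have hprob : ∀ u ∈ I, Real.exp (-(x * s + 1)) * (3 * p) ^ J
      ≤ (boltzmannMeasure q N).real (mergeEvent p k (β u)) := by
    intro u hu
    refine le_trans ?_ (exp_mul_pow_le_boltzmannMeasure_real_mergeEvent hx hB.eq_exp hJ hJk hp
      (Nat.succ_pos (p * u)) (hβ u hu) (hsmall u hu))
    have h1 : x * s ≤ x * ((p * u + 1 : ℕ) * p ^ k) := by
      have : (s : ℝ) ≤ (p * u + 1 : ℕ) * p ^ k := by exact_mod_cast hlow u hu
      gcongr
    have h2 : (3 * p : ℝ) ≤ 3 * (x * ((p * u + 1 : ℕ) * p ^ k)) / (4 * J) := by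
      rw [le_div_iff₀ (by positivity)]
      linarith
    have h3 : Real.exp (-(x * s + 1)) ≤ Real.exp (-(x * ((p * u + 1 : ℕ) * p ^ k))) :=
      Real.exp_le_exp.2 (neg_le_neg (hup u hu))
    exact mul_le_mul h3 (pow_le_pow_left₀ (by positivity) h2 J) (by positivity)
      (Real.exp_pos _).le
  have hno := boltzmannMeasure_real_forall_notMem_le (q := q) I
    (fun u => Finset.univ.image (β u)) (fun u => mergeEvent p k (β u))
    (fun u hu w hw huw => by
      rw [Finset.disjoint_left]
      intro a ha hb
      obtain ⟨i, -, rfl⟩ := Finset.mem_image.1 ha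
      obtain ⟨j, -, hj⟩ := Finset.mem_image.1 hb
      have h1 : (p * u + 1) * p ^ i.val = (p * w + 1) * p ^ j.val := by
        rw [← hβ u hu, ← hβ w hw, hj]
      have h2 := eq_of_mul_pow_eq_mul_pow (by omega) (hcop u) (hcop w) h1
      exact huw (Nat.eq_of_mul_eq_mul_left (by omega : 0 < p) (by omega)))
    fun u _ => dependsOn_mergeEvent p k (β u)
  have hcard := hB.card_le (a := 0) (n := N) rfl
    (Finset.univ.filter fun ν : Nat.Partition N => ¬ HasMergeableParts p s ν.parts)
    (A := {v | ∀ u ∈ I, v ∉ mergeEvent p k (β u)}) fun ν hν u hu hmem => by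
      exact (Finset.mem_filter.1 hν).2 (hasMergeableParts_of_mem_mergeEvent hp (hcop u)
        (Nat.succ_pos (p * u)) hJk (hβ u hu) (hlow u hu) hmem)
  rw [Nat.card_eq_fintype_card, Fintype.card_subtype]
  refine hcard.trans ?_
  rw [pow_zero, mul_one]
  refine mul_le_mul_of_nonneg_left (hno.trans (Real.exp_le_exp.2 (neg_le_neg ?_))) (by positivity)
  refine le_trans (le_of_eq ?_) (Finset.card_nsmul_le_sum I _ _ hprob)
  rw [nsmul_eq_mul, hI, Nat.card_Ico, add_tsub_cancel_left]

end UnmergeablePartitions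

section Asymptotics

/-- Powers of `ℓ` are dominated by `exp (b * (ℓ / p))` when `p ≤ ℓ / (log ℓ) ^ 2`. -/
theorem eventually_mul_pow_le_exp_div (A : ℝ) (k : ℕ) {b : ℝ} (hb : 0 < b) :
    ∀ᶠ ℓ : ℝ in Filter.atTop, ∀ p : ℝ, 0 < p → p ≤ ℓ / Real.log ℓ ^ 2 →
      A * ℓ ^ k ≤ Real.exp (b * (ℓ / p)) := by
  filter_upwards [Real.tendsto_log_atTop.eventually (Filter.eventually_ge_atTop
    (max 1 (max |A| ((k + 1) / b)))), Filter.eventually_gt_atTop 0] with ℓ hL hℓ p hp hpL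
  have h1 : 1 ≤ Real.log ℓ := (le_max_left _ _).trans hL
  have h2 : |A| ≤ Real.log ℓ := (le_max_left _ _).trans ((le_max_right _ _).trans hL)
  have h3 : (k + 1) / b ≤ Real.log ℓ := (le_max_right _ _).trans ((le_max_right _ _).trans hL)
  set L := Real.log ℓ with hLdef
  have hexp : Real.exp L = ℓ := Real.exp_log hℓ
  have h4 : L ^ 2 ≤ ℓ / p := by
    rw [le_div_iff₀ (by positivity)] at hpL ⊢
    linarith
  rw [div_le_iff₀ hb] at h3
  have h5 : A ≤ Real.exp L := by
    have := Real.add_one_le_exp L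
    linarith [le_abs_self A]
  calc A * ℓ ^ k ≤ Real.exp L * ℓ ^ k := by gcongr
    _ = Real.exp ((k + 1) * L) := by
      rw [← hexp, ← Real.exp_nat_mul, ← Real.exp_add]
      congr 1
      ring
    _ ≤ Real.exp (b * (ℓ / p)) := by
      rw [Real.exp_le_exp]
      calc (k + 1) * L ≤ L * b * L := by gcongr
        _ = b * L ^ 2 := by ring
        _ ≤ _ := by gcongr

/-- The part size above which merged parts are considered. -/
noncomputable def mergeThreshold (ℓ x : ℝ) (p : ℕ) : ℕ := ⌈(1 / 2 + 1 / (11 * p)) * ℓ / x⌉₊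

theorem le_mul_mergeThreshold {ℓ x : ℝ} (hx : 0 < x) (p : ℕ) :
    (1 / 2 + 1 / (11 * p)) * ℓ ≤ x * mergeThreshold ℓ x p := by
  have h := Nat.le_ceil ((1 / 2 + 1 / (11 * p)) * ℓ / x)
  rw [div_le_iff₀ hx] at h
  rw [mul_comm x]
  exact h

theorem mul_mergeThreshold_le {ℓ x : ℝ} (hℓ : 0 ≤ ℓ) (hx : 0 < x) (p : ℕ) :
    x * mergeThreshold ℓ x p ≤ (1 / 2 + 1 / (11 * p)) * ℓ + x := by
  have h := Nat.ceil_lt_add_one (show 0 ≤ (1 / 2 + 1 / (11 * p)) * ℓ / x by positivity)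
  have h1 := mul_le_mul_of_nonneg_left h.le hx.le
  rw [mul_add, mul_div_cancel₀ _ hx.ne', mul_one] at h1
  exact h1

theorem eventually_card_not_hasMergeableParts_le :
    ∀ᶠ N : ℕ in Filter.atTop, ∀ p : ℕ, 1 < p →
      (p : ℝ) ≤ Real.log N / Real.log (Real.log N) ^ 2 →
      ∀ (q : unitInterval) (x : ℝ), IsBoltzmannParameter N q x →
      (Nat.card {ν : Nat.Partition N //
        ¬ HasMergeableParts p (mergeThreshold (Real.log N) x p) ν.parts} : ℝ)
        ≤ Fintype.card (Nat.Partition N) * Real.exp (-Real.log N) := by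
  have hE := (eventually_mul_pow_le_exp_div (144 * Real.exp 3) 5
    (show (0 : ℝ) < 3 / 88 by norm_num)).and
    ((eventually_mul_pow_le_exp 72 4 (show (0 : ℝ) < 3 / 8 by norm_num)).and
    ((eventually_mul_pow_le_exp 4 1 (show (0 : ℝ) < 1 / 2 by norm_num)).and
    ((Real.tendsto_log_atTop.eventually (Filter.eventually_ge_atTop 3)).and
    (Filter.eventually_ge_atTop (100 : ℝ)))))
  filter_upwards [tendsto_log_natCast_atTop.eventually hE, Filter.eventually_ge_atTop 144]
    with N ⟨hA, h72, h4, hL3, hℓ⟩ hN144 p hp hpL q x hB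
  have hx := hB.pos
  have hN0 : (0 : ℝ) < N := by exact_mod_cast (by omega : 0 < N)
  set ℓ := Real.log N with hℓdef
  have hexp : Real.exp ℓ = N := Real.exp_log hN0
  have hsqrt : √(N : ℝ) = Real.exp (1 / 2 * ℓ) := by
    rw [Real.sqrt_eq_rpow, Real.rpow_def_of_pos hN0, mul_comm]
  have hp2 : (2 : ℝ) ≤ p := by exact_mod_cast hp
  have hp0 : (0 : ℝ) < p := by linarith
  have hup := hB.mul_sqrt_le
  rw [hsqrt] at hup
  have hxE : x ≤ 4 * ℓ * Real.exp (-(1 / 2 * ℓ)) := by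
    rw [Real.exp_neg, ← div_eq_mul_inv, le_div_iff₀ (Real.exp_pos _)]
    exact hup
  have hx1 : x ≤ 1 := by
    rw [pow_one] at h4
    have h1 : x * Real.exp (1 / 2 * ℓ) ≤ 1 * Real.exp (1 / 2 * ℓ) := by linarith
    exact le_of_mul_le_mul_right h1 (Real.exp_pos _)
  have hxN : 1 ≤ 2 * x * N := by
    have h1 := hB.one_le
    have h2 : 12 ≤ √(N : ℝ) := by
      rw [Real.le_sqrt' (by norm_num)]
      have : (144 : ℝ) ≤ N := by exact_mod_cast hN144
      linarith
    have h3 : √(N : ℝ) * √N = N := Real.mul_self_sqrt hN0.le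
    have h4 : 12 * (√(N : ℝ) * x) ≤ √N * (√(N : ℝ) * x) := by gcongr
    have h5 : √N * (√(N : ℝ) * x) = N * x := by rw [← mul_assoc, h3]
    linarith
  have hpL' : p * Real.log ℓ ^ 2 ≤ ℓ := by
    rwa [le_div_iff₀ (by positivity)] at hpL
  have hp8 : 8 * p ≤ ℓ := by
    have h1 : 9 ≤ Real.log ℓ ^ 2 := by nlinarith
    nlinarith
  set J := ⌊ℓ / (8 * p)⌋₊ with hJdef
  have hJ1 : 1 ≤ J := by
    rw [hJdef, Nat.one_le_floor_iff, le_div_iff₀ (by positivity)]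
    linarith
  have hJle : (J : ℝ) ≤ ℓ / (8 * p) := Nat.floor_le (by positivity)
  have hJge : ℓ / (8 * p) - 1 ≤ J := (Nat.sub_one_lt_floor _).le
  have hpJ : (p : ℝ) * J ≤ 1 / 8 * ℓ := by
    rw [le_div_iff₀ (by positivity)] at hJle
    linarith
  set s := mergeThreshold ℓ x p with hs
  have hs1 := le_mul_mergeThreshold (ℓ := ℓ) hx p
  have hs2 := mul_mergeThreshold_le (ℓ := ℓ) (by linarith) hx p
  rw [← hs] at hs1 hs2
  have hδ : ℓ / (11 * p) ≤ ℓ / 22 := div_le_div_of_nonneg_left (by linarith) (by norm_num)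
    (by linarith)
  have hδ0 : 0 ≤ ℓ / (11 * p) := by positivity
  have hδe : (1 / 2 + 1 / (11 * p)) * ℓ = ℓ / 2 + ℓ / (11 * p) := by ring
  rw [hδe] at hs1 hs2
  set l := Nat.clog p ⌈2 * ℓ⌉₊ with hl
  have hl1 : 2 * ℓ ≤ (p : ℝ) ^ l := by
    have h1 := Nat.le_pow_clog hp ⌈2 * ℓ⌉₊
    exact (Nat.le_ceil _).trans (by exact_mod_cast h1)
  have hl2 : (p : ℝ) ^ l ≤ 3 * ℓ * p := by
    have h0 : 1 < ⌈2 * ℓ⌉₊ := by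
      rw [Nat.lt_ceil]
      push_cast
      linarith
    have h1 := Nat.pow_pred_clog_lt_self hp h0
    have h2 : ((p ^ (Nat.clog p ⌈2 * ℓ⌉₊).pred : ℕ) : ℝ) ≤ ⌈2 * ℓ⌉₊ := by exact_mod_cast h1.le
    have h3 : (⌈2 * ℓ⌉₊ : ℝ) < 2 * ℓ + 1 := Nat.ceil_lt_add_one (by linarith)
    have h4 : l.pred + 1 = l := Nat.succ_pred_eq_of_pos (Nat.clog_pos hp h0)
    rw [← h4, pow_succ]
    push_cast at h2
    refine mul_le_mul_of_nonneg_right ?_ hp0.le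
    linarith
  set Z : ℝ := p ^ (l + 1) with hZ
  have hZ0 : 0 < Z := by positivity
  have hZle : Z ≤ 3 * ℓ ^ 3 := by
    have h1 : (p : ℝ) ≤ ℓ := by linarith
    calc Z = p ^ l * p := pow_succ _ _
      _ ≤ 3 * ℓ * p * p := by gcongr
      _ ≤ 3 * ℓ * ℓ * ℓ := by gcongr
      _ = _ := by ring
  have hPJ : (p : ℝ) ^ J ≤ Real.exp (1 / 8 * ℓ) := by
    have h1 : (p : ℝ) ≤ Real.exp p := by
      have := Real.add_one_le_exp (p : ℝ)
      linarith
    calc (p : ℝ) ^ J ≤ Real.exp p ^ J := by gcongr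
      _ = Real.exp (J * p) := (Real.exp_nat_mul _ _).symm
      _ ≤ _ := by
        rw [Real.exp_le_exp]
        linarith
  set k := J + l with hk
  have hpk : (p : ℝ) ^ (k + 1) = p ^ J * Z := by
    rw [hZ, ← pow_add, hk, add_assoc]
  set X : ℝ := x * (p ^ J * Z) with hX
  have hX0 : 0 < X := by positivity
  have hX6 : 6 * X ≤ 1 := by
    have h1 : X ≤ (4 * ℓ * Real.exp (-(1 / 2 * ℓ))) * (Real.exp (1 / 8 * ℓ) * (3 * ℓ ^ 3)) := by
      rw [hX]
      gcongr
    have h2 : (4 * ℓ * Real.exp (-(1 / 2 * ℓ))) * (Real.exp (1 / 8 * ℓ) * (3 * ℓ ^ 3))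
        = 12 * ℓ ^ 4 * Real.exp (-(3 / 8 * ℓ)) := by
      have : Real.exp (-(3 / 8 * ℓ)) = Real.exp (-(1 / 2 * ℓ)) * Real.exp (1 / 8 * ℓ) := by
        rw [← Real.exp_add]
        congr 1
        ring
      rw [this]
      ring
    have h3 : 72 * ℓ ^ 4 * Real.exp (-(3 / 8 * ℓ)) ≤ 1 := by
      rw [Real.exp_neg, ← div_eq_mul_inv, div_le_one (Real.exp_pos _)]
      exact h72
    linarith
  have hfl : 2 ≤ ⌊1 / X⌋₊ := by
    rw [Nat.le_floor_iff (by positivity), le_div_iff₀ hX0]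
    push_cast
    linarith
  set n := ⌊1 / X⌋₊ - 2 with hn
  have hn2 : ((n : ℝ) + 2) = ⌊1 / X⌋₊ := by
    rw [hn, Nat.cast_sub hfl]
    push_cast
    ring
  have hnX : ((n : ℝ) + 2) * X ≤ 1 := by
    rw [hn2, ← le_div_iff₀ hX0]
    exact Nat.floor_le (by positivity)
  have hnlow : 1 / (2 * X) ≤ n := by
    have h1 := Nat.lt_floor_add_one (1 / X)
    rw [← hn2] at h1
    have h2 : 3 ≤ 1 / (2 * X) := by
      rw [le_div_iff₀ (by positivity)]
      linarith
    have h3 : 1 / X = 1 / (2 * X) + 1 / (2 * X) := by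
      field_simp
      norm_num
    linarith
  have hmain := hB.card_not_hasMergeableParts_le (s := s) (k := k) (n := n) hp hJ1 (by omega)
    (by rw [hpk]; linarith) (by linarith)
    (by
      rw [hk, pow_add, mul_comm ((p : ℝ) ^ J)]
      refine mul_le_mul_of_nonneg_right ?_ (by positivity)
      linarith) hxN
  have hkey : 6 * ℓ ≤ n * (Real.exp (-(x * s + 1)) * (3 * p) ^ J) := by
    have h1 : Real.exp (ℓ / (8 * p) - 1) ≤ (3 : ℝ) ^ J := by
      calc Real.exp (ℓ / (8 * p) - 1) ≤ Real.exp (J * 1) := by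
            rw [Real.exp_le_exp]
            linarith
        _ = Real.exp 1 ^ J := Real.exp_nat_mul _ _
        _ ≤ _ := by
          have := Real.exp_one_lt_d9
          gcongr
          linarith
    have h2 : Real.exp (-(ℓ / 2 + ℓ / (11 * p) + 2)) ≤ Real.exp (-(x * s + 1)) := by
      rw [Real.exp_le_exp]
      linarith
    have h3 : 144 * Real.exp 3 * ℓ ^ 5 ≤ Real.exp (3 / 88 * (ℓ / p)) := hA p hp0 hpL
    have h5 : x * Z ≤ 12 * ℓ ^ 4 * Real.exp (-(1 / 2 * ℓ)) := by
      calc x * Z ≤ (4 * ℓ * Real.exp (-(1 / 2 * ℓ))) * (3 * ℓ ^ 3) := by gcongr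
        _ = _ := by ring
    have h6 : 6 * ℓ * (2 * (x * Z))
        ≤ Real.exp (-(ℓ / 2 + ℓ / (11 * p) + 2)) * Real.exp (ℓ / (8 * p) - 1) := by
      calc 6 * ℓ * (2 * (x * Z)) ≤ 6 * ℓ * (2 * (12 * ℓ ^ 4 * Real.exp (-(1 / 2 * ℓ)))) := by
            gcongr
        _ = 144 * Real.exp 3 * ℓ ^ 5 * (Real.exp (-(1 / 2 * ℓ)) * Real.exp (-3)) := by
            have : Real.exp 3 * Real.exp (-3) = 1 := by
              rw [← Real.exp_add]
              norm_num
            linear_combination (-144 * ℓ ^ 5 * Real.exp (-(1 / 2 * ℓ))) * this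
        _ ≤ Real.exp (3 / 88 * (ℓ / p)) * (Real.exp (-(1 / 2 * ℓ)) * Real.exp (-3)) := by gcongr
        _ = _ := by
            rw [← Real.exp_add, ← Real.exp_add, ← Real.exp_add]
            congr 1
            field_simp
            ring
    calc 6 * ℓ = 6 * ℓ * (2 * (x * Z)) / (2 * (x * Z)) := by field_simp
      _ ≤ (Real.exp (-(x * s + 1)) * 3 ^ J) / (2 * (x * Z)) := by
        refine div_le_div_of_nonneg_right ?_ (by positivity)
        exact h6.trans (mul_le_mul h2 h1 (Real.exp_pos _).le (Real.exp_pos _).le)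
      _ = 1 / (2 * X) * (Real.exp (-(x * s + 1)) * (3 * p) ^ J) := by
        rw [hX, mul_pow]
        field_simp
      _ ≤ _ := by gcongr
  refine hmain.trans ?_
  rw [mul_comm ((N : ℝ) ^ 5), mul_assoc]
  refine mul_le_mul_of_nonneg_left ?_ (by positivity)
  nth_rewrite 1 [← hexp]
  rw [← Real.exp_nat_mul, ← Real.exp_add, Real.exp_le_exp]
  push_cast
  linarith

theorem mul_exp_neg_le_mul_exp_neg {a b : ℝ} (ha : 1 ≤ a) (hab : a ≤ b) :
    b * Real.exp (-b) ≤ a * Real.exp (-a) := by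
  have h1 : b ≤ a * Real.exp (b - a) := by
    have h2 := Real.add_one_le_exp (b - a)
    calc b ≤ a * (b - a + 1) := by nlinarith
      _ ≤ _ := by gcongr
  calc b * Real.exp (-b) ≤ a * Real.exp (b - a) * Real.exp (-b) := by gcongr
    _ = a * (Real.exp (b - a) * Real.exp (-b)) := by ring
    _ = _ := by
      rw [← Real.exp_add]
      congr 2
      ring

theorem eventually_mul_sum_count_le :
    ∀ᶠ N : ℕ in Filter.atTop, ∀ p : ℕ, 1 < p →
      (p : ℝ) ≤ Real.log N / Real.log (Real.log N) ^ 2 →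
      ∀ (q : unitInterval) (x : ℝ), IsBoltzmannParameter N q x →
      (∀ t ≤ N, (Fintype.card (Nat.Partition (N - t)) : ℝ)
        ≤ 40 * Fintype.card (Nat.Partition N) * Real.exp (-(x * (1 - 10 / Real.log N))) ^ t) →
      ∀ t, mergeThreshold (Real.log N) x p ≤ t → t ≤ N →
        (t : ℝ) * ∑ ν : Nat.Partition (N - t), (1 + (ν.parts.count t : ℝ))
          ≤ Fintype.card (Nat.Partition N) * Real.exp (-(Real.log N / (12 * p))) := by
  have hE := (eventually_mul_pow_le_exp_div (3840 * Real.exp 6) 1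
    (show (0 : ℝ) < 1 / 132 by norm_num)).and (Filter.eventually_ge_atTop (100 : ℝ))
  filter_upwards [tendsto_log_natCast_atTop.eventually hE, Filter.eventually_ge_atTop 1]
    with N ⟨hA, hℓ⟩ hN1 p hp hpL q x hB hdecay t hst htN
  have hx := hB.pos
  have hN0 : (0 : ℝ) < N := by exact_mod_cast hN1
  have hlow := hB.one_le
  set pN : ℝ := (Fintype.card (Nat.Partition N) : ℝ) with hpN
  have hpN0 : 0 ≤ pN := by positivity
  set ℓ := Real.log N with hℓdef
  have hsqrt : √(N : ℝ) = Real.exp (1 / 2 * ℓ) := by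
    rw [Real.sqrt_eq_rpow, Real.rpow_def_of_pos hN0, mul_comm]
  rw [hsqrt] at hlow
  have hp2 : (2 : ℝ) ≤ p := by exact_mod_cast hp
  have hp0 : (0 : ℝ) < p := by linarith
  have hδ : ℓ / (11 * p) ≤ ℓ / 22 := div_le_div_of_nonneg_left (by linarith) (by norm_num)
    (by linarith)
  have hδ0 : 0 ≤ ℓ / (11 * p) := by positivity
  have hδe : (1 / 2 + 1 / (11 * p)) * ℓ = ℓ / 2 + ℓ / (11 * p) := by ring
  have hs1 := le_mul_mergeThreshold (ℓ := ℓ) hx p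
  rw [hδe] at hs1
  set r := 1 - 10 / ℓ with hr
  have hr2 : 1 / 2 ≤ r := by
    have : 10 / ℓ ≤ 1 / 2 := by
      rw [div_le_iff₀ (by linarith)]
      linarith
    rw [hr]
    linarith
  set y := x * r with hy
  have hy0 : 0 < y := by positivity
  set a := ℓ / 2 + ℓ / (11 * p) - 6 with ha
  have hat : a ≤ y * t := by
    have h1 : ((mergeThreshold ℓ x p : ℕ) : ℝ) ≤ t := by exact_mod_cast hst
    calc a ≤ (ℓ / 2 + ℓ / (11 * p)) * r := by
          have h2 : (ℓ / 2 + ℓ / (11 * p)) * r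
              = ℓ / 2 + ℓ / (11 * p) - (5 + 10 / (11 * p)) := by
            rw [hr]
            field_simp
            ring
          have h3 : 10 / (11 * (p : ℝ)) ≤ 1 := by
            rw [div_le_one (by positivity)]
            linarith
          rw [h2, ha]
          linarith
      _ ≤ x * mergeThreshold ℓ x p * r := by gcongr
      _ ≤ x * t * r := by gcongr
      _ = _ := by
        rw [hy]
        ring
  have ha1 : 1 ≤ a := by
    rw [ha]
    linarith
  have ht1 : 1 ≤ t := by
    by_contra h
    have h0 : t = 0 := by omega
    rw [h0, Nat.cast_zero, mul_zero] at hat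
    linarith
  have hqt : Real.exp (-y) ^ t = Real.exp (-(y * t)) := by
    rw [← Real.exp_nat_mul]
    congr 1
    ring
  have hsum := sum_one_add_count_parts_le (N := N) (t := t) (K := 40 * pN) (q := Real.exp (-y))
    (by positivity) (Real.exp_pos _) (by rw [Real.exp_lt_one_iff]; linarith) ht1 hdecay htN
  rw [hqt] at hsum
  have hhalf : Real.exp (-(y * t)) ≤ 1 / 2 := by
    have h1 : Real.exp (-(y * t)) ≤ Real.exp (-1) := Real.exp_le_exp.2 (by linarith)
    have h2 : Real.exp (-1) ≤ 1 / 2 := by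
      rw [Real.exp_neg, ← one_div]
      have := Real.exp_one_gt_d9
      exact one_div_le_one_div_of_le (by norm_num) (by linarith)
    linarith
  have hsum2 : 40 * pN * Real.exp (-(y * t)) / (1 - Real.exp (-(y * t)))
      ≤ 80 * pN * Real.exp (-(y * t)) := by
    rw [div_le_iff₀ (by linarith)]
    have h1 : 0 ≤ pN * Real.exp (-(y * t)) := by positivity
    nlinarith
  have hte : t * Real.exp (-(y * t))
      ≤ 48 * Real.exp (1 / 2 * ℓ) * (ℓ * Real.exp (-a)) := by
    have h1 := mul_exp_neg_le_mul_exp_neg ha1 hat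
    have h2 : 1 ≤ 48 * Real.exp (1 / 2 * ℓ) * y := by
      calc (1 : ℝ) ≤ 24 * Real.exp (1 / 2 * ℓ) * x := hlow
        _ = 48 * Real.exp (1 / 2 * ℓ) * (x * (1 / 2)) := by ring
        _ ≤ _ := by
          rw [hy]
          gcongr
    have h3 : a ≤ ℓ := by
      rw [ha]
      linarith
    calc t * Real.exp (-(y * t)) = 1 * (t * Real.exp (-(y * t))) := (one_mul _).symm
      _ ≤ 48 * Real.exp (1 / 2 * ℓ) * y * (t * Real.exp (-(y * t))) := by gcongr
      _ = 48 * Real.exp (1 / 2 * ℓ) * (y * t * Real.exp (-(y * t))) := by ring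
      _ ≤ 48 * Real.exp (1 / 2 * ℓ) * (a * Real.exp (-a)) := by gcongr
      _ ≤ _ := by gcongr
  have hAp := hA p hp0 hpL
  rw [pow_one] at hAp
  calc (t : ℝ) * ∑ ν : Nat.Partition (N - t), (1 + (ν.parts.count t : ℝ))
      ≤ t * (80 * pN * Real.exp (-(y * t))) := by
        gcongr
        exact hsum.trans hsum2
    _ = 80 * pN * (t * Real.exp (-(y * t))) := by ring
    _ ≤ 80 * pN * (48 * Real.exp (1 / 2 * ℓ) * (ℓ * Real.exp (-a))) := by gcongr
    _ = pN * (3840 * Real.exp 6 * ℓ * Real.exp (-(ℓ / (11 * p)))) := by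
        have : Real.exp (1 / 2 * ℓ) * Real.exp (-a)
            = Real.exp 6 * Real.exp (-(ℓ / (11 * p))) := by
          rw [← Real.exp_add, ← Real.exp_add, ha]
          congr 1
          ring
        linear_combination (3840 * pN * ℓ) * this
    _ ≤ pN * (Real.exp (1 / 132 * (ℓ / p)) * Real.exp (-(ℓ / (11 * p)))) := by gcongr
    _ = _ := by
        rw [← Real.exp_add]
        congr 2
        field_simp
        ring

end Asymptotics

/-- There exist an absolute constant `C > 0` and an absolute constant `N₀`
such that for every integer `N ≥ N₀` and every prime `p ≤ (log N)/(log log N)²`, the number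
of pairs `(χ, c)`, with `χ` an irreducible complex character of `S_N` and `c` a conjugacy
class of `S_N`, such that the value of `χ` on `c` is not of the form `p·m` for any integer
`m`, is at most `C · p(N)² · N^(−1/(12p))`. -/
theorem character_entries_indivisible_by_p_bound :
    ∃ C : ℝ, 0 < C ∧ ∃ N₀ : ℕ, ∀ N : ℕ, N₀ ≤ N → ∀ p : ℕ, p.Prime →
      (p : ℝ) ≤ Real.log N / (Real.log (Real.log N)) ^ 2 →
      (Set.ncard {χc : (Equiv.Perm (Fin N) → ℂ) × ConjClasses (Equiv.Perm (Fin N)) |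
          (∃ V : FDRep ℂ (Equiv.Perm (Fin N)), Simple V ∧ χc.1 = V.character) ∧
          ∀ g : Equiv.Perm (Fin N), ConjClasses.mk g = χc.2 →
            ¬ ∃ m : ℤ, χc.1 g = (p : ℂ) * (m : ℂ)} : ℝ) ≤
        C * (Fintype.card (Nat.Partition N) : ℝ) ^ 2 *
          (N : ℝ) ^ (-(1 : ℝ) / (12 * (p : ℝ))) := by
  have hev := (eventually_card_not_hasMergeableParts_le.and eventually_mul_sum_count_le).and
    (exists_boltzmann_parameter_decay.and
      (tendsto_log_natCast_atTop.eventually ((Filter.eventually_ge_atTop (4 : ℝ)).and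
        (eventually_mul_pow_le_exp 4 1 (show (0 : ℝ) < 1 / 2 by norm_num)))))
  obtain ⟨N₀, hN₀⟩ := Filter.eventually_atTop.1 (hev.and (Filter.eventually_ge_atTop 1))
  refine ⟨2, by norm_num, N₀, fun N hN p hp hpL => ?_⟩
  obtain ⟨⟨⟨h1, h2⟩, ⟨q, x, hB, hdecay⟩, hℓ, h4⟩, hN1⟩ := hN₀ N hN
  have hx := hB.pos
  have hN0 : (0 : ℝ) < N := by exact_mod_cast hN1
  have hfail := h1 p hp.one_lt hpL q x hB
  have hsum := h2 p hp.one_lt hpL q x hB hdecay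
  have hup := hB.mul_sqrt_le
  have hsqrt : √(N : ℝ) = Real.exp (1 / 2 * Real.log N) := by
    rw [Real.sqrt_eq_rpow, Real.rpow_def_of_pos hN0, mul_comm]
  rw [hsqrt] at hup
  set pN : ℝ := (Fintype.card (Nat.Partition N) : ℝ) with hpN
  set ℓ := Real.log N with hℓdef
  have hx1 : x ≤ 1 := by
    rw [pow_one] at h4
    have h1 : x * Real.exp (1 / 2 * ℓ) ≤ 1 * Real.exp (1 / 2 * ℓ) := by linarith
    exact le_of_mul_le_mul_right h1 (Real.exp_pos _)
  have hp0 : (1 : ℝ) ≤ p := by exact_mod_cast hp.one_lt.le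
  have hs : 2 ≤ mergeThreshold ℓ x p := by
    have h5 := le_mul_mergeThreshold (ℓ := ℓ) hx p
    have h6 : (1 / 2 + 1 / (11 * (p : ℝ))) * ℓ = ℓ / 2 + ℓ / (11 * p) := by ring
    have h7 : 0 ≤ ℓ / (11 * p) := by positivity
    have h8 : x * mergeThreshold ℓ x p ≤ 1 * mergeThreshold ℓ x p := by gcongr
    have h9 : (2 : ℝ) ≤ mergeThreshold ℓ x p := by linarith
    exact_mod_cast h9
  have hmain := ncard_indivisible_entries_le hp hs (by positivity) hsum
  refine hmain.trans ?_
  have hrpow : (N : ℝ) ^ (-(1 : ℝ) / (12 * (p : ℝ))) = Real.exp (-(ℓ / (12 * p))) := by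
    rw [Real.rpow_def_of_pos hN0]
    congr 1
    ring
  have hexp : Real.exp (-ℓ) ≤ Real.exp (-(ℓ / (12 * p))) := by
    rw [Real.exp_le_exp]
    have : ℓ / (12 * p) ≤ ℓ := div_le_self (by linarith) (by linarith)
    linarith
  rw [hrpow]
  calc _ ≤ pN * (pN * Real.exp (-(ℓ / (12 * p)))) + pN * (pN * Real.exp (-(ℓ / (12 * p)))) := by
        gcongr
        exact hfail.trans (by gcongr)
    _ = _ := by ring
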